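/- arXiv:1606.08788 — 12 statements merged into one kernel-verified Lean document; each statement's English description precedes it below -/
import Mathlib

section
/- For the reactive SAIS model, the region Ω = {(a,i) ∈ ℝ² : a ≥ 0, i ≥ 0, a + i ≤ 1} is forward-invariant: if a, i : ℝ → ℝ are differentiable functions satisfying a'(t) = α_i(i(t))·s(t)·i(t) + α_a(i(t))·s(t)·a(t) + p(i(t))·δ·i(t) − β_a·a(t)·i(t) − δ_a(i(t))·a(t) and i'(t) = (β·s(t) + β_a·a(t) − δ)·i(t) with s(t) = 1 − a(t) − i(t) for all t ≥ 0, and (a(0), i(0)) ∈ Ω, then (a(t), i(t)) ∈ Ω for all t ≥ 0. -/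
open Set Filter

lemma sais_min_sq (x : ℝ) : HasDerivAt (fun y : ℝ => (min y 0)^2) (2 * min x 0) x := by
  rcases lt_trichotomy x 0 with h | h | h
  · have h1 : HasDerivAt (fun y : ℝ => y^2) (2 * min x 0) x := by
      have := hasDerivAt_pow 2 x
      rw [min_eq_left h.le]
      simpa using this
    refine h1.congr_of_eventuallyEq ?_
    filter_upwards [Iio_mem_nhds h] with y hy
    rw [min_eq_left (le_of_lt hy)]
  · subst h
    have h1 : HasDerivAt (fun y : ℝ => y^2) 0 0 := by
      simpa using hasDerivAt_pow 2 (0:ℝ)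
    rw [hasDerivAt_iff_isLittleO] at h1 ⊢
    refine Asymptotics.IsBigO.trans_isLittleO ?_ h1
    refine Asymptotics.IsBigO.of_bound 1 (Eventually.of_forall fun y => ?_)
    simp only [min_self, mul_zero, smul_zero, sub_zero, Real.norm_eq_abs, one_mul]
    rcases le_total y 0 with hy | hy
    · simp [min_eq_left hy]
    · simp [min_eq_right hy, sq_nonneg]
  · have h1 : HasDerivAt (fun _ : ℝ => (0:ℝ)) (2 * min x 0) x := by
      rw [min_eq_right h.le, mul_zero]
      exact hasDerivAt_const x 0
    refine h1.congr_of_eventuallyEq ?_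
    filter_upwards [Ioi_mem_nhds h] with y hy
    rw [min_eq_right (le_of_lt hy)]
    simp

lemma sais_gronwall (V V' : ℝ → ℝ) (K T : ℝ)
    (hV : ∀ t ∈ Icc 0 T, HasDerivAt V (V' t) t)
    (hle : ∀ t ∈ Icc 0 T, V' t ≤ K * V t) (h0 : V 0 ≤ 0) :
    ∀ t ∈ Icc 0 T, V t ≤ 0 := by
  have hd : ∀ t ∈ Icc 0 T, HasDerivAt (fun t => V t * Real.exp (-K * t))
      (V' t * Real.exp (-K * t) + V t * (Real.exp (-K * t) * (-K))) t := by
    intro t ht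
    have h2 : HasDerivAt (fun t : ℝ => -K * t) (-K) t := by
      simpa using (hasDerivAt_id t).const_mul (-K)
    exact (hV t ht).mul h2.exp
  have hanti : AntitoneOn (fun t => V t * Real.exp (-K * t)) (Icc 0 T) := by
    refine antitoneOn_of_deriv_nonpos (convex_Icc 0 T)
      (fun t ht => (hd t ht).continuousAt.continuousWithinAt)
      (fun t ht => (hd t (interior_subset ht)).differentiableAt.differentiableWithinAt) ?_
    intro t ht
    rw [(hd t (interior_subset ht)).deriv]
    have := hle t (interior_subset ht)
    nlinarith [Real.exp_pos (-K * t)]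
  intro t ht
  have h := hanti ⟨le_refl 0, ht.1.trans ht.2⟩ ht ht.1
  simp only [mul_zero, Real.exp_zero, mul_one] at h
  by_contra hc
  push Not at hc
  have := mul_pos hc (Real.exp_pos (-K * t))
  linarith

lemma sais_bound (f : ℝ → ℝ) (T : ℝ) (hf : ContinuousOn f (Icc 0 T)) :
    ∃ M, 0 ≤ M ∧ ∀ t ∈ Icc 0 T, |f t| ≤ M := by
  obtain ⟨M, hM⟩ := isCompact_Icc.exists_bound_of_continuousOn hf
  exact ⟨max M 0, le_max_right _ _, fun t ht => (hM t ht).trans (le_max_left _ _)⟩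

lemma sais_min_nonneg {x : ℝ} (h : (min x 0)^2 ≤ 0) : 0 ≤ x := by
  have : min x 0 = 0 := by nlinarith [pow_eq_zero_iff (two_ne_zero) |>.1 (le_antisymm h (sq_nonneg (min x 0)))]
  exact min_eq_right_iff.1 this

/- algebraic core -/
lemma sais_alg (M a s c1 c2 k1 k4 r1 r2 : ℝ)
    (h1 : |c1| ≤ M) (h2 : |c2| ≤ M) (h3 : |k1| ≤ M) (h4 : |k4| ≤ M)
    (hk1 : 0 ≤ k1) (hk4 : 0 ≤ k4) (hr1 : 0 ≤ r1) (hr2 : 0 ≤ r2) :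
    2 * min a 0 * (c1 * a + k1 * s + r1) + 2 * min s 0 * (- c2 * s + k4 * a + r2)
      ≤ 4 * M * ((min a 0)^2 + (min s 0)^2) := by
  have ha : min a 0 * a = (min a 0)^2 := by
    rcases le_total a 0 with h | h
    · rw [min_eq_left h]; ring
    · rw [min_eq_right h]; ring
  have hs : min s 0 * s = (min s 0)^2 := by
    rcases le_total s 0 with h | h
    · rw [min_eq_left h]; ring
    · rw [min_eq_right h]; ring
  have hn : min a 0 ≤ 0 := min_le_right _ _
  have hm : min s 0 ≤ 0 := min_le_right _ _
  have hna : min a 0 ≤ a := min_le_left _ _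
  have hms : min s 0 ≤ s := min_le_left _ _
  generalize min a 0 = n at *
  generalize min s 0 = m at *
  have e1 : c1 * n^2 ≤ M * n^2 := mul_le_mul_of_nonneg_right (abs_le.1 h1).2 (sq_nonneg n)
  have e2 : -c2 * m^2 ≤ M * m^2 :=
    mul_le_mul_of_nonneg_right (by linarith [(abs_le.1 h2).1]) (sq_nonneg m)
  have hnm : 0 ≤ n * m := mul_nonneg_of_nonpos_of_nonpos hn hm
  have e3 : k1 * (n * s) ≤ k1 * (n * m) :=
    mul_le_mul_of_nonneg_left (mul_le_mul_of_nonpos_left hms hn) hk1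
  have e3' : k1 * (n * m) ≤ M * (n * m) := mul_le_mul_of_nonneg_right (abs_le.1 h3).2 hnm
  have e4 : k4 * (m * a) ≤ k4 * (m * n) :=
    mul_le_mul_of_nonneg_left (mul_le_mul_of_nonpos_left hna hm) hk4
  have e4' : k4 * (n * m) ≤ M * (n * m) := mul_le_mul_of_nonneg_right (abs_le.1 h4).2 hnm
  have e5 : n * r1 ≤ 0 := mul_nonpos_of_nonpos_of_nonneg hn hr1
  have e6 : m * r2 ≤ 0 := mul_nonpos_of_nonpos_of_nonneg hm hr2
  have hM : 0 ≤ M := (abs_nonneg _).trans h1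
  have e7 : 0 ≤ M * (n - m)^2 := mul_nonneg hM (sq_nonneg _)
  have key : 2 * n * (c1 * a + k1 * s + r1) + 2 * m * (- c2 * s + k4 * a + r2)
    = 2 * (c1 * (n * a) + k1 * (n * s) + n * r1 - c2 * (m * s) + k4 * (m * a) + m * r2) := by ring
  rw [key, ha, hs]
  nlinarith

theorem sais_forward_invariant
    (αi αa p δa : ℝ → ℝ) (β βa δ : ℝ)
    (hαi_diff : DifferentiableOn ℝ αi (Set.Icc 0 1))
    (hαa_diff : DifferentiableOn ℝ αa (Set.Icc 0 1))
    (hp_diff : DifferentiableOn ℝ p (Set.Icc 0 1))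
    (hδa_diff : DifferentiableOn ℝ δa (Set.Icc 0 1))
    (hαi_nonneg : ∀ x ∈ Set.Icc (0:ℝ) 1, 0 ≤ αi x)
    (hαa_nonneg : ∀ x ∈ Set.Icc (0:ℝ) 1, 0 ≤ αa x)
    (hp_nonneg : ∀ x ∈ Set.Icc (0:ℝ) 1, 0 ≤ p x)
    (hδa_nonneg : ∀ x ∈ Set.Icc (0:ℝ) 1, 0 ≤ δa x)
    (hp_le_one : ∀ x ∈ Set.Icc (0:ℝ) 1, p x ≤ 1)
    (hδa0_pos : 0 < δa 0)
    (hαa_pos : ∀ x ∈ Set.Ioc (0:ℝ) 1, 0 < αa x)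
    (hαip_pos : ∀ x ∈ Set.Ioc (0:ℝ) 1, 0 < αi x + p x)
    (hβa_nonneg : 0 ≤ βa) (hβaβ : βa < β) (hδ_pos : 0 < δ)
    (a i : ℝ → ℝ)
    (hda : ∀ t : ℝ, 0 ≤ t → HasDerivAt a (αi (i t) * (1 - a t - i t) * (i t) + αa (i t) * (1 - a t - i t) * (a t) + p (i t) * δ * (i t) - βa * (a t) * (i t) - δa (i t) * (a t)) t)
    (hdi : ∀ t : ℝ, 0 ≤ t → HasDerivAt i ((β * (1 - a t - i t) + βa * (a t) - δ) * (i t)) t)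
    (ha0 : 0 ≤ a 0) (hi0 : 0 ≤ i 0) (hsum0 : a 0 + i 0 ≤ 1) :
    ∀ t : ℝ, 0 ≤ t → 0 ≤ a t ∧ 0 ≤ i t ∧ a t + i t ≤ 1 := by
  have hac : ContinuousOn a (Ici 0) := fun t ht => (hda t ht).continuousAt.continuousWithinAt
  have hic : ContinuousOn i (Ici 0) := fun t ht => (hdi t ht).continuousAt.continuousWithinAt
  have hsub : ∀ T : ℝ, Icc 0 T ⊆ Ici 0 := fun T t ht => ht.1
  -- nonnegativity of the infectious fraction
  have hi : ∀ t, 0 ≤ t → 0 ≤ i t := by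
    intro T hT
    have hac' := hac.mono (hsub T)
    have hic' := hic.mono (hsub T)
    obtain ⟨M, hM0, hM⟩ := sais_bound (fun t => β * (1 - a t - i t) + βa * (a t) - δ) T
      (by fun_prop)
    refine sais_min_nonneg (sais_gronwall (fun t => (min (i t) 0)^2)
      (fun t => 2 * min (i t) 0 * ((β * (1 - a t - i t) + βa * (a t) - δ) * (i t))) (2 * M) T
      ?_ ?_ ?_ T ⟨hT, le_refl T⟩)
    · intro t ht
      exact (sais_min_sq (i t)).comp t (hdi t ht.1)
    · intro t ht
      have h1 := (abs_le.1 (hM t ht)).2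
      have ha : min (i t) 0 * i t = (min (i t) 0)^2 := by
        rcases le_total (i t) 0 with h | h
        · rw [min_eq_left h]; ring
        · rw [min_eq_right h]; ring
      have h2 := mul_le_mul_of_nonneg_right h1 (sq_nonneg (min (i t) 0))
      show 2 * min (i t) 0 * ((β * (1 - a t - i t) + βa * (a t) - δ) * (i t)) ≤ 2 * M * (min (i t) 0)^2
      rw [← ha] at h2 ⊢
      linarith
    · simp [min_eq_right hi0]
  -- as long as the infectious fraction is at most one, the other two are nonnegative
  have hA : ∀ T, 0 ≤ T → (∀ t ∈ Icc 0 T, i t ≤ 1) → 0 ≤ a T ∧ 0 ≤ 1 - a T - i T := by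
    intro T hT hi1
    have hac' := hac.mono (hsub T)
    have hic' := hic.mono (hsub T)
    have hmaps : MapsTo i (Icc 0 T) (Icc 0 1) := fun t ht => ⟨hi t ht.1, hi1 t ht⟩
    have hc1 : ContinuousOn (fun t => αi (i t)) (Icc 0 T) := hαi_diff.continuousOn.comp hic' hmaps
    have hc2 : ContinuousOn (fun t => αa (i t)) (Icc 0 T) := hαa_diff.continuousOn.comp hic' hmaps
    have hc4 : ContinuousOn (fun t => δa (i t)) (Icc 0 T) := hδa_diff.continuousOn.comp hic' hmaps
    obtain ⟨M1, hM10, hM1⟩ := sais_bound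
      (fun t => αa (i t) * (1 - a t - i t) - βa * i t - δa (i t)) T
      (((hc2.mul ((continuousOn_const.sub hac').sub hic')).sub (continuousOn_const.mul hic')).sub hc4)
    obtain ⟨M2, hM20, hM2⟩ := sais_bound
      (fun t => αi (i t) * i t + αa (i t) * a t + β * i t) T
      (((hc1.mul hic').add (hc2.mul hac')).add (continuousOn_const.mul hic'))
    obtain ⟨M3, hM30, hM3⟩ := sais_bound (fun t => αi (i t) * i t) T (hc1.mul hic')
    obtain ⟨M4, hM40, hM4⟩ := sais_bound (fun t => δa (i t)) T hc4
    have hV := sais_gronwall (fun t => (min (a t) 0)^2 + (min (1 - a t - i t) 0)^2)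
      (fun t => 2 * min (a t) 0 * (αi (i t) * (1 - a t - i t) * (i t) + αa (i t) * (1 - a t - i t) * (a t) + p (i t) * δ * (i t) - βa * (a t) * (i t) - δa (i t) * (a t))
        + 2 * min (1 - a t - i t) 0 * (- (αi (i t) * (1 - a t - i t) * (i t) + αa (i t) * (1 - a t - i t) * (a t) + p (i t) * δ * (i t) - βa * (a t) * (i t) - δa (i t) * (a t)) - (β * (1 - a t - i t) + βa * (a t) - δ) * (i t)))
      (4 * (M1 + M2 + M3 + M4)) T ?_ ?_ ?_ T ⟨hT, le_refl T⟩
    · exact ⟨sais_min_nonneg (by nlinarith [sq_nonneg (min (1 - a T - i T) 0)]),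
        sais_min_nonneg (by nlinarith [sq_nonneg (min (a T) 0)])⟩
    · intro t ht
      have hs := (((hda t ht.1).const_sub 1).sub (hdi t ht.1))
      exact ((sais_min_sq (a t)).comp t (hda t ht.1)).add
        (HasDerivAt.comp (h₂ := fun y : ℝ => (min y 0)^2) t (sais_min_sq (1 - a t - i t)) hs)
    · intro t ht
      have hit := hmaps ht
      have h := sais_alg (M1 + M2 + M3 + M4) (a t) (1 - a t - i t)
        (αa (i t) * (1 - a t - i t) - βa * i t - δa (i t))
        (αi (i t) * i t + αa (i t) * a t + β * i t) (αi (i t) * i t) (δa (i t))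
        (p (i t) * δ * i t) ((1 - p (i t)) * δ * i t)
        ((hM1 t ht).trans (by linarith)) ((hM2 t ht).trans (by linarith))
        ((hM3 t ht).trans (by linarith)) ((hM4 t ht).trans (by linarith))
        (mul_nonneg (hαi_nonneg _ hit) hit.1) (hδa_nonneg _ hit)
        (mul_nonneg (mul_nonneg (hp_nonneg _ hit) hδ_pos.le) hit.1)
        (mul_nonneg (mul_nonneg (sub_nonneg.2 (hp_le_one _ hit)) hδ_pos.le) hit.1)
      refine le_trans (le_of_eq ?_) h
      ring
    · have : 0 ≤ 1 - a 0 - i 0 := by linarith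
      simp [min_eq_right ha0, min_eq_right this]
  -- the infectious fraction never exceeds one
  have hi1 : ∀ t, 0 ≤ t → i t ≤ 1 := by
    by_contra hcon
    push Not at hcon
    obtain ⟨t1, ht1, hit1⟩ := hcon
    set S : Set ℝ := {t | 0 ≤ t ∧ 1 < i t} with hS
    have hSne : S.Nonempty := ⟨t1, ht1, hit1⟩
    have hSb : BddBelow S := ⟨0, fun t ht => ht.1⟩
    set τ := sInf S with hτ
    have hτ0 : 0 ≤ τ := le_csInf hSne fun t ht => ht.1
    have hbefore : ∀ t, 0 ≤ t → t < τ → i t ≤ 1 := by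
      intro t h0 h1
      by_contra hc
      push Not at hc
      exact absurd (csInf_le hSb (show t ∈ S from ⟨h0, hc⟩)) (not_le.2 h1)
    have hcτ : ContinuousAt i τ := (hdi τ hτ0).continuousAt
    have hle : i τ ≤ 1 := by
      rcases hτ0.eq_or_lt with h | h
      · rw [← h]; linarith
      · refine le_of_tendsto (hcτ.tendsto.mono_left (nhdsWithin_le_nhds (s := Iio τ))) ?_
        filter_upwards [Ioo_mem_nhdsLT h] with t ht
        exact hbefore t ht.1.le ht.2
    have hfreq : ∃ᶠ t in nhdsWithin τ (Ioi τ), 1 < i t := by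
      rw [frequently_iff]
      intro U hU
      obtain ⟨u, hu, hUu⟩ := mem_nhdsGT_iff_exists_Ioo_subset.1 hU
      obtain ⟨t, ht, htu⟩ := exists_lt_of_csInf_lt hSne (show sInf S < u from hu)
      have h1 : τ ≤ t := csInf_le hSb ht
      have h2 : τ ≠ t := by
        intro h
        rw [h] at hle
        exact absurd ht.2 (not_lt.2 hle)
      exact ⟨t, hUu ⟨lt_of_le_of_ne h1 h2, htu⟩, ht.2⟩
    have hge : 1 ≤ i τ := by
      by_contra hc
      push Not at hc
      have : ∀ᶠ t in nhdsWithin τ (Ioi τ), i t < 1 :=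
        (hcτ.eventually_lt_const hc).filter_mono nhdsWithin_le_nhds
      obtain ⟨t, h1, h2⟩ := (hfreq.and_eventually this).exists
      linarith
    have hiτ : i τ = 1 := le_antisymm hle hge
    obtain ⟨h1, h2⟩ := hA τ hτ0 (by
      intro t ht
      rcases ht.2.eq_or_lt with h | h
      · rw [h]; exact hle
      · exact hbefore t ht.1 h)
    have haτ : a τ = 0 := by linarith
    have hd := hdi τ hτ0
    rw [haτ, hiτ] at hd
    have hd' : HasDerivWithinAt i (-δ) (Ioi τ) τ := by
      have : (β * (1 - 0 - 1) + βa * 0 - δ) * 1 = -δ := by ring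
      rw [this] at hd
      exact hd.hasDerivWithinAt
    have hsl := (hasDerivWithinAt_iff_tendsto_slope' (by simp)).1 hd'
    have hev := hsl.eventually_lt_const (show -δ < 0 by linarith)
    obtain ⟨t, ht1, ht2, ht3⟩ := (hfreq.and_eventually (hev.and self_mem_nhdsWithin)).exists
    rw [slope_def_field, hiτ] at ht2
    have : 0 < (i t - 1) / (t - τ) := div_pos (by linarith) (sub_pos.2 ht3)
    linarith
  intro t ht
  obtain ⟨h1, h2⟩ := hA t ht fun u hu => hi1 u hu.1
  exact ⟨h1, hi t ht, by linarith⟩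
end

section
/- In the reactive SAIS model, if β > δ > β_a and (β − δ)/(β − β_a) > 1 − δ_a(0)/α_a(0) (where α_a(0) > 0), then there exists at least one endemic equilibrium, i.e., a point (a*, i*) with a* > 0, i* > 0, a* + i* < 1 satisfying α_i(i*)·s*·i* + α_a(i*)·s*·a* + p(i*)·δ·i* − β_a·a*·i* − δ_a(i*)·a* = 0 and β·s* + β_a·a* − δ = 0 with s* = 1 − a* − i*. -/
open Set Filter

theorem sais_endemic_equilibrium_exists
    (αi αa p δa : ℝ → ℝ) (β βa δ : ℝ)
    (hαi_diff : DifferentiableOn ℝ αi (Set.Icc 0 1))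
    (hαa_diff : DifferentiableOn ℝ αa (Set.Icc 0 1))
    (hp_diff : DifferentiableOn ℝ p (Set.Icc 0 1))
    (hδa_diff : DifferentiableOn ℝ δa (Set.Icc 0 1))
    (hαi_nonneg : ∀ x ∈ Set.Icc (0:ℝ) 1, 0 ≤ αi x)
    (hαa_nonneg : ∀ x ∈ Set.Icc (0:ℝ) 1, 0 ≤ αa x)
    (hp_nonneg : ∀ x ∈ Set.Icc (0:ℝ) 1, 0 ≤ p x)
    (hδa_nonneg : ∀ x ∈ Set.Icc (0:ℝ) 1, 0 ≤ δa x)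
    (hp_le_one : ∀ x ∈ Set.Icc (0:ℝ) 1, p x ≤ 1)
    (hδa0_pos : 0 < δa 0)
    (hαa_pos : ∀ x ∈ Set.Ioc (0:ℝ) 1, 0 < αa x)
    (hαip_pos : ∀ x ∈ Set.Ioc (0:ℝ) 1, 0 < αi x + p x)
    (hβa_nonneg : 0 ≤ βa) (hβaβ : βa < β) (hδ_pos : 0 < δ)
    (hβδ : δ < β) (hδβa : βa < δ)
    (hαa0_pos : 0 < αa 0)
    (hthr : (β - δ) / (β - βa) > 1 - δa 0 / αa 0) :
    ∃ a0 i0 : ℝ, 0 < a0 ∧ 0 < i0 ∧ a0 + i0 < 1 ∧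
      αi (i0) * (1 - a0 - i0) * (i0) + αa (i0) * (1 - a0 - i0) * (a0) + p (i0) * δ * (i0) - βa * (a0) * (i0) - δa (i0) * (a0) = 0 ∧
      β * (1 - a0 - i0) + βa * a0 - δ = 0 := by
  have hD : 0 < β - βa := by linarith
  have hβ : 0 < β := by linarith
  set I : ℝ := (β - δ) / β with hI
  have hI0 : 0 < I := div_pos (by linarith) hβ
  have hβI : β * I = β - δ := by rw [hI]; field_simp
  have hI1 : I < 1 := by rw [hI, div_lt_one hβ]; linarith
  let A : ℝ → ℝ := fun x => (β - δ - β * x) / (β - βa)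
  have hA : ∀ x, A x * (β - βa) = β - δ - β * x := fun x => div_mul_cancel₀ _ hD.ne'
  have hAc : Continuous A := by
    show Continuous (fun x : ℝ => (β - δ - β * x) / (β - βa))
    fun_prop
  let f : ℝ → ℝ := fun x => αi x * (1 - A x - x) * x + αa x * (1 - A x - x) * (A x)
    + p x * δ * x - βa * (A x) * x - δa x * (A x)
  have hsub : Set.Icc 0 I ⊆ Set.Icc (0:ℝ) 1 := Set.Icc_subset_Icc le_rfl hI1.le
  have c1 := hαi_diff.continuousOn.mono hsub
  have c2 := hαa_diff.continuousOn.mono hsub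
  have c3 := hp_diff.continuousOn.mono hsub
  have c4 := hδa_diff.continuousOn.mono hsub
  have c5 : ContinuousOn A (Set.Icc 0 I) := hAc.continuousOn
  have hf : ContinuousOn f (Set.Icc 0 I) := by
    show ContinuousOn (fun x => αi x * (1 - A x - x) * x + αa x * (1 - A x - x) * (A x)
      + p x * δ * x - βa * (A x) * x - δa x * (A x)) _
    fun_prop
  have h0 : f 0 < 0 := by
    have hA0 : A 0 = (β - δ) / (β - βa) := by simp [A]
    have hpos : 0 < A 0 := by rw [hA0]; exact div_pos (by linarith) hD
    have h1 : 1 - A 0 < δa 0 / αa 0 := by rw [hA0]; linarith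
    rw [lt_div_iff₀ hαa0_pos] at h1
    have : f 0 = A 0 * ((1 - A 0) * αa 0 - δa 0) := by simp only [f]; ring
    rw [this]
    exact mul_neg_of_pos_of_neg hpos (by linarith)
  have h1 : 0 < f I := by
    have hAI : A I = 0 := by simp [A, hβI]
    have hm : I ∈ Set.Ioc (0:ℝ) 1 := ⟨hI0, hI1.le⟩
    have hm' : I ∈ Set.Icc (0:ℝ) 1 := ⟨hI0.le, hI1.le⟩
    have : f I = I * (αi I * (1 - I) + p I * δ) := by simp only [f, hAI]; ring
    rw [this]
    apply mul_pos hI0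
    rcases (hαi_nonneg I hm').lt_or_eq with h | h
    · have := mul_pos h (sub_pos.2 hI1)
      have := mul_nonneg (hp_nonneg I hm') hδ_pos.le
      linarith
    · have h2 := hαip_pos I hm
      rw [← h, zero_add] at h2
      rw [← h, zero_mul, zero_add]
      exact mul_pos h2 hδ_pos
  obtain ⟨x, ⟨hx0, hxI⟩, hx⟩ := intermediate_value_Ioo hI0.le hf (show (0:ℝ) ∈ Set.Ioo (f 0) (f I) from ⟨h0, h1⟩)
  have hβx : β * x < β * I := mul_lt_mul_of_pos_left hxI hβ
  have hβx0 : 0 < β * x := mul_pos hβ hx0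
  have hAx : 0 < A x := div_pos (by linarith) hD
  have hAx1 : A x < 1 := by
    show (β - δ - β * x) / (β - βa) < 1
    rw [div_lt_one hD]; linarith
  refine ⟨A x, x, hAx, hx0, ?_, hx, ?_⟩
  · have h3 : βa * A x ≤ βa := mul_le_of_le_one_right hβa_nonneg hAx1.le
    have h4 : 0 < β * (1 - A x - x) := by have := hA x; linarith
    have := pos_of_mul_pos_right h4 hβ.le
    linarith
  · have := hA x; linarith
end

section
/- Consider the reactive SAIS model with constant rate coefficients α_i(i) = α_i, α_a(i) = α_a, p(i) = p, δ_a(i) = δ_a. If β > δ and (β − δ)/(β − β_a) > 1 − δ_a/α_a, then there exists exactly one interior equilibrium, i.e., exactly one point (a*, i*) with a* > 0, i* > 0, a* + i* < 1 satisfying α_i·s*·i* + α_a·s*·a* + p·δ·i* − β_a·a*·i* − δ_a·a* = 0 and β·s* + β_a·a* − δ = 0 with s* = 1 − a* − i*. -/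
open Set Filter

theorem quad_aux (c2 c1 c0 M : ℝ) (h0 : 0 < c0) (hM : 0 < M)
    (hM' : c2 * M^2 + c1 * M + c0 < 0) :
    ∃ t, (0 < t ∧ t < M ∧ c2 * t^2 + c1 * t + c0 = 0) ∧
      ∀ y, 0 < y → y < M → c2 * y^2 + c1 * y + c0 = 0 → y = t := by
  have hc : ContinuousOn (fun t : ℝ => c2 * t^2 + c1 * t + c0) (Icc 0 M) := by fun_prop
  obtain ⟨t, ht, hr⟩ := intermediate_value_Ioo' hM.le hc
    (show (0:ℝ) ∈ Ioo _ _ from ⟨hM', by simpa using h0⟩)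
  simp only at hr
  refine ⟨t, ⟨ht.1, ht.2, hr⟩, ?_⟩
  intro y y0 yM hy
  by_contra hne
  have h1 : c2 * (y + t) + c1 = 0 := by
    apply mul_left_cancel₀ (sub_ne_zero.mpr hne)
    linear_combination hy - hr
  have h2 : c0 = c2 * (y * t) := by linear_combination hr - t * h1
  have hyt : 0 < y * t := mul_pos y0 ht.1
  have h3 : 0 < c2 := by
    rw [h2] at h0
    exact (pos_iff_pos_of_mul_pos h0).mpr hyt
  have h4 : c2 * M^2 + c1 * M + c0 = c2 * ((M - y) * (M - t)) := by
    linear_combination h2 + M * h1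
  have := mul_pos h3 (mul_pos (sub_pos.mpr yM) (sub_pos.mpr ht.2))
  linarith

theorem sais_const_unique_interior_equilibrium
    (αi αa p δa β βa δ : ℝ)
    (hαi_nonneg : 0 ≤ αi) (hαa_pos : 0 < αa)
    (hp_nonneg : 0 ≤ p) (hp_le_one : p ≤ 1)
    (hαip_pos : 0 < αi + p)
    (hδa_pos : 0 < δa) (hδ_pos : 0 < δ)
    (hβa_nonneg : 0 ≤ βa) (hβaβ : βa < β)
    (hβδ : δ < β)
    (hthr : (β - δ) / (β - βa) > 1 - δa / αa) :
    ∃! e : ℝ × ℝ, 0 < e.1 ∧ 0 < e.2 ∧ e.1 + e.2 < 1 ∧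
      αi * (1 - e.1 - e.2) * (e.2) + αa * (1 - e.1 - e.2) * (e.1) + p * δ * (e.2) - βa * (e.1) * (e.2) - δa * (e.1) = 0 ∧
      β * (1 - e.1 - e.2) + βa * e.1 - δ = 0 := by
  have hβ : 0 < β := hδ_pos.trans hβδ
  obtain ⟨u, rfl⟩ : ∃ u, δ = u * β := ⟨δ / β, by field_simp⟩
  obtain ⟨v, rfl⟩ : ∃ v, βa = v * β := ⟨βa / β, by field_simp⟩
  have u0 : 0 < u := pos_of_mul_pos_left hδ_pos hβ.le
  have u1 : 0 < 1 - u := by nlinarith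
  have v0 : 0 ≤ v := nonneg_of_mul_nonneg_left hβa_nonneg hβ
  have v1 : 0 < 1 - v := by nlinarith
  have hA : 1 - δa / αa < (1 - u) / (1 - v) := by
    have : (β - u * β) / (β - v * β) = (1 - u) / (1 - v) := by
      rw [show β - u * β = β * (1 - u) by ring, show β - v * β = β * (1 - v) by ring,
        mul_div_mul_left _ _ hβ.ne']
    rw [← this]; exact hthr
  set c2 := αi * v * (1 - v) - αa * v + v * β * (1 - v) with hc2
  set c1 := -αi * (u * (1 - v) + v * (1 - u)) + αa * u - p * (u * β) * (1 - v)
    - v * β * (1 - u) - δa with hc1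
  set c0 := αi * u * (1 - u) + p * (u * β) * (1 - u) with hc0
  have key : ∀ t, c2 * t^2 + c1 * t + c0 = αi * (u - v * t) * ((1 - u) - (1 - v) * t)
      + αa * (u - v * t) * t + p * (u * β) * ((1 - u) - (1 - v) * t)
      - v * β * t * ((1 - u) - (1 - v) * t) - δa * t := by
    intro t; rw [hc2, hc1, hc0]; ring
  have h0 : 0 < c0 := by
    have : c0 = (αi + p * β) * (u * (1 - u)) := by rw [hc0]; ring
    rw [this]
    apply mul_pos _ (mul_pos u0 u1)
    rcases hαi_nonneg.lt_or_eq with h | h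
    · positivity
    · have : 0 < p := by linarith
      positivity
  have hMex : ∃ M, 0 < M ∧ c2 * M^2 + c1 * M + c0 < 0 ∧
      ∀ t, 0 < t → (t < M ↔ (0 < (1 - u) - (1 - v) * t ∧ 0 < u - v * t)) := by
    rcases le_or_gt v u with h | h
    · refine ⟨(1 - u) / (1 - v), div_pos u1 v1, ?_, ?_⟩
      · set A := (1 - u) / (1 - v) with hAd
        have hA0 : 0 < A := div_pos u1 v1
        have e : (1 - v) * A = 1 - u := by rw [hAd]; field_simp
        rw [key, e]
        have e2 : u - v * A = 1 - A := by linear_combination e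
        rw [e2]
        have h5 : αa * (1 - A) < δa := by
          have : 1 - A < δa / αa := by linarith
          rw [lt_div_iff₀ hαa_pos] at this
          linarith
        nlinarith
      · intro t ht
        rw [lt_div_iff₀ v1]
        constructor
        · intro h6
          refine ⟨by linarith, ?_⟩
          by_contra h7
          have : t < 1 := by nlinarith
          nlinarith
        · rintro ⟨h6, -⟩; linarith
    · have vp : 0 < v := u0.trans h
      refine ⟨u / v, div_pos u0 vp, ?_, ?_⟩
      · set A := u / v with hAd
        have hA0 : 0 < A := div_pos u0 vp
        have e : v * A = u := by rw [hAd]; field_simp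
        have hA1 : A < 1 := by rw [hAd, div_lt_one vp]; exact h
        rw [key]
        have e2 : (1 - u) - (1 - v) * A = 1 - A := by linear_combination e
        rw [e2, e]
        have e3 : v * β * A = u * β := by linear_combination β * e
        rw [e3]
        have h7 : 0 ≤ (1 - p) * (u * β * (1 - A)) :=
          mul_nonneg (by linarith) (mul_nonneg hδ_pos.le (by linarith))
        have h8 := mul_pos hδa_pos hA0
        nlinarith
      · intro t ht
        rw [lt_div_iff₀ vp]
        constructor
        · intro h6
          have : t < 1 := by
            by_contra h9
            nlinarith
          refine ⟨by nlinarith, by linarith⟩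
        · rintro ⟨-, h6⟩; linarith
  obtain ⟨M, hM, hM', hiff⟩ := hMex
  obtain ⟨t, ⟨t0, tM, htr⟩, huniq⟩ := quad_aux c2 c1 c0 M h0 hM hM'
  obtain ⟨hi, hs⟩ := (hiff t t0).mp tM
  refine ⟨(t, (1 - u) - (1 - v) * t), ⟨t0, hi, ?_, ?_, ?_⟩, ?_⟩
  · show t + ((1 - u) - (1 - v) * t) < 1
    linarith
  · rw [key] at htr
    simp only
    linear_combination htr
  · simp only
    ring
  · rintro ⟨a, i⟩ ⟨a0, i0, hlt, hg, hf⟩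
    simp only at a0 i0 hlt hg hf
    have hi' : i = (1 - u) - (1 - v) * a := by
      apply mul_left_cancel₀ hβ.ne'
      linear_combination -hf
    subst hi'
    have : a = t := by
      apply huniq a a0 ((hiff a a0).mpr ⟨i0, by linarith⟩)
      rw [key]
      linear_combination hg
    rw [this]
end

section
/- Consider the reactive SAIS model and suppose β > δ, the functions α_i, α_a, p are nondecreasing on [0,1], δ ≥ β_a, the function δ_a is nonincreasing on [0,1], and α_a(0) > β − β_a. If (β − δ)/(β − β_a) > 1 − δ_a(0)/α_a(0), then there exists exactly one interior equilibrium, i.e., exactly one point (a*, i*) with a* > 0, i* > 0, a* + i* < 1 at which both right-hand sides of the system vanish. -/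
open Set Filter

theorem sais_unique_interior_equilibrium_a2
    (αi αa p δa : ℝ → ℝ) (β βa δ : ℝ)
    (hαi_diff : DifferentiableOn ℝ αi (Set.Icc 0 1))
    (hαa_diff : DifferentiableOn ℝ αa (Set.Icc 0 1))
    (hp_diff : DifferentiableOn ℝ p (Set.Icc 0 1))
    (hδa_diff : DifferentiableOn ℝ δa (Set.Icc 0 1))
    (hαi_nonneg : ∀ x ∈ Set.Icc (0:ℝ) 1, 0 ≤ αi x)
    (hαa_nonneg : ∀ x ∈ Set.Icc (0:ℝ) 1, 0 ≤ αa x)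
    (hp_nonneg : ∀ x ∈ Set.Icc (0:ℝ) 1, 0 ≤ p x)
    (hδa_nonneg : ∀ x ∈ Set.Icc (0:ℝ) 1, 0 ≤ δa x)
    (hp_le_one : ∀ x ∈ Set.Icc (0:ℝ) 1, p x ≤ 1)
    (hδa0_pos : 0 < δa 0)
    (hαa_pos : ∀ x ∈ Set.Ioc (0:ℝ) 1, 0 < αa x)
    (hαip_pos : ∀ x ∈ Set.Ioc (0:ℝ) 1, 0 < αi x + p x)
    (hβa_nonneg : 0 ≤ βa) (hβaβ : βa < β) (hδ_pos : 0 < δ)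
    (hβδ : δ < β)
    (hαi_mono : MonotoneOn αi (Set.Icc 0 1))
    (hαa_mono : MonotoneOn αa (Set.Icc 0 1))
    (hp_mono : MonotoneOn p (Set.Icc 0 1))
    (hδβa : βa ≤ δ)
    (hδa_anti : AntitoneOn δa (Set.Icc 0 1))
    (hαa0_big : β - βa < αa 0)
    (hthr : (β - δ) / (β - βa) > 1 - δa 0 / αa 0) :
    ∃! e : ℝ × ℝ, 0 < e.1 ∧ 0 < e.2 ∧ e.1 + e.2 < 1 ∧
      αi (e.2) * (1 - e.1 - e.2) * (e.2) + αa (e.2) * (1 - e.1 - e.2) * (e.1) + p (e.2) * δ * (e.2) - βa * (e.1) * (e.2) - δa (e.2) * (e.1) = 0 ∧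
      (β * (1 - e.1 - e.2) + βa * (e.1) - δ) * (e.2) = 0 := by
  have hb : 0 < β - βa := by linarith
  have hβ : 0 < β := by linarith
  -- pairwise uniqueness
  have key : ∀ a i b j : ℝ, 0 < a → 0 < i → a + i < 1 →
      αi i * (1 - a - i) * i + αa i * (1 - a - i) * a + p i * δ * i - βa * a * i - δa i * a = 0 →
      (β * (1 - a - i) + βa * a - δ) = 0 → 0 < b → 0 < j → b + j < 1 →
      αi j * (1 - b - j) * j + αa j * (1 - b - j) * b + p j * δ * j - βa * b * j - δa j * b = 0 →
      (β * (1 - b - j) + βa * b - δ) = 0 → i < j → False := by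
    intro a i b j ha hi hai h1 h2 hb0 hj hbj h3 h4 hij
    have mi : i ∈ Set.Icc (0:ℝ) 1 := ⟨hi.le, by linarith⟩
    have mj : j ∈ Set.Icc (0:ℝ) 1 := ⟨hj.le, by linarith⟩
    have m0 : (0:ℝ) ∈ Set.Icc (0:ℝ) 1 := ⟨le_rfl, by norm_num⟩
    have e1 := hαi_mono mi mj hij.le
    have e2 := hαa_mono mi mj hij.le
    have e3 := hp_mono mi mj hij.le
    have e4 := hδa_anti mi mj hij.le
    have e5 := hαa_mono m0 mi hi.le
    have e6 := hαip_pos i ⟨hi, mi.2⟩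
    have n1 := hαi_nonneg i mi
    have n2 := hp_nonneg i mi
    have hba : b < a := by
      have : (β - βa) * (a - b) = β * (j - i) := by linarith
      have h : 0 < (β - βa) * (a - b) := by rw [this]; exact mul_pos hβ (by linarith)
      have := (mul_pos_iff_of_pos_left hb).1 h
      linarith
    obtain ⟨s, hs⟩ : ∃ s, s = 1 - a - i := ⟨_, rfl⟩
    obtain ⟨t, ht⟩ : ∃ t, t = 1 - b - j := ⟨_, rfl⟩
    rw [← hs] at h1 h2
    rw [← ht] at h3 h4
    have hs0 : 0 < s := by linarith
    have hst : (β - βa) * (t - s) = βa * (j - i) := by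
      rw [show a = 1 - s - i by linarith] at h2
      rw [show b = 1 - t - j by linarith] at h4
      linarith
    have hts : 0 ≤ t - s := by
      have h : 0 ≤ (β - βa) * (t - s) := by
        rw [hst]; exact mul_nonneg hβa_nonneg (by linarith)
      exact (mul_nonneg_iff_of_pos_left hb).1 h
    have hG : αa i * s - βa * i - δa i ≤ αa j * t - βa * j - δa j := by
      have q1 : αa i * t ≤ αa j * t := mul_le_mul_of_nonneg_right e2 (by linarith)
      have q2 : (β - βa) * (t - s) ≤ αa i * (t - s) :=
        mul_le_mul_of_nonneg_right (by linarith) hts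
      linarith
    have hX0 : 0 < αi i * s + p i * δ := by
      rcases n1.lt_or_eq with h | h
      · have := mul_pos h hs0
        have := mul_nonneg n2 hδ_pos.le
        linarith
      · have hp : 0 < p i := by linarith
        have := mul_nonneg n1 hs0.le
        have := mul_pos hp hδ_pos
        linarith
    have hX : αi i * s + p i * δ ≤ αi j * t + p j * δ := by
      have q1 : αi i * s ≤ αi j * t := mul_le_mul e1 (by linarith) hs0.le (by linarith)
      have q2 : p i * δ ≤ p j * δ := mul_le_mul_of_nonneg_right e3 hδ_pos.le
      linarith
    generalize hGi : αa i * s - βa * i - δa i = G at *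
    generalize hGj : αa j * t - βa * j - δa j = H at *
    generalize hXi : αi i * s + p i * δ = X at *
    generalize hXj : αi j * t + p j * δ = Y at *
    have h1' : X * i + G * a = 0 := by rw [← hXi, ← hGi]; linarith
    have h3' : Y * j + H * b = 0 := by rw [← hXj, ← hGj]; linarith
    have hXi0 : 0 < X * i := mul_pos hX0 hi
    have hGneg : G < 0 := by
      by_contra h
      have := mul_nonneg (not_lt.1 h) ha.le
      linarith
    have q1 : G * b ≤ H * b := mul_le_mul_of_nonneg_right hG hb0.le
    have q2 : G * a ≤ G * b := mul_le_mul_of_nonpos_left hba.le hGneg.le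
    have q3 : X * i < X * j := mul_lt_mul_of_pos_left hij hX0
    have q4 : X * j ≤ Y * j := mul_le_mul_of_nonneg_right hX hj.le
    linarith
  -- existence
  have hex : ∃ i a : ℝ, 0 < a ∧ 0 < i ∧ a + i < 1 ∧
      αi i * (1 - a - i) * i + αa i * (1 - a - i) * a + p i * δ * i - βa * a * i - δa i * a = 0 ∧
      β * (1 - a - i) + βa * a - δ = 0 := by
    obtain ⟨A, hA⟩ : ∃ A : ℝ → ℝ, A = fun i => (β - δ - β * i) / (β - βa) := ⟨_, rfl⟩
    have hAeq : ∀ i, (β - βa) * A i = β - δ - β * i := by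
      intro i; rw [hA]; field_simp
    obtain ⟨c, hc⟩ : ∃ c, c = (β - δ) / β := ⟨_, rfl⟩
    have hcβ : β * c = β - δ := by rw [hc]; field_simp
    have hc0 : 0 < c := by rw [hc]; exact div_pos (by linarith) hβ
    have hc1 : c < 1 := by rw [hc, div_lt_one hβ]; linarith
    have hsub : Set.Icc 0 c ⊆ Set.Icc (0:ℝ) 1 := Set.Icc_subset_Icc le_rfl hc1.le
    have hs : ∀ i, 0 < i → 0 < 1 - A i - i := by
      intro i hi
      have e : (β - βa) * (1 - A i - i) = δ - βa + βa * i := by linarith [hAeq i]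
      have h : 0 < (β - βa) * (1 - A i - i) := by
        rw [e]
        rcases hβa_nonneg.lt_or_eq with h | h
        · have := mul_pos h hi
          linarith
        · rw [← h]; linarith
      exact (mul_pos_iff_of_pos_left hb).1 h
    have hAc : ContinuousOn A (Set.Icc 0 c) := by
      rw [hA]; fun_prop
    have c1 := hαi_diff.continuousOn.mono hsub
    have c2 := hαa_diff.continuousOn.mono hsub
    have c3 := hp_diff.continuousOn.mono hsub
    have c4 := hδa_diff.continuousOn.mono hsub
    have hF : ContinuousOn (fun i => αi i * (1 - A i - i) * i + αa i * (1 - A i - i) * A i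
        + p i * δ * i - βa * A i * i - δa i * A i) (Set.Icc 0 c) := by
      fun_prop
    have hAzero : A c = 0 := by
      have := hAeq c
      rw [hcβ, sub_self] at this
      exact (mul_eq_zero.1 this).resolve_left hb.ne'
    have hA0 : 0 < A 0 := by
      rw [hA]; exact div_pos (by linarith) hb
    have hαa0 : 0 < αa 0 := by linarith
    have hthr2 : αa 0 * (1 - A 0) < δa 0 := by
      have h : 1 - A 0 < δa 0 / αa 0 := by
        have : A 0 = (β - δ) / (β - βa) := by rw [hA]; simp
        rw [this]; linarith
      rw [lt_div_iff₀ hαa0] at h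
      linarith
    have hF0 : αi 0 * (1 - A 0 - 0) * 0 + αa 0 * (1 - A 0 - 0) * A 0
        + p 0 * δ * 0 - βa * A 0 * 0 - δa 0 * A 0 < 0 := by
      have := mul_lt_mul_of_pos_right hthr2 hA0
      linarith
    have hFc : 0 < αi c * (1 - A c - c) * c + αa c * (1 - A c - c) * A c
        + p c * δ * c - βa * A c * c - δa c * A c := by
      rw [hAzero]
      have mc : c ∈ Set.Icc (0:ℝ) 1 := ⟨hc0.le, hc1.le⟩
      have n1 := hαi_nonneg c mc
      have n2 := hp_nonneg c mc
      have e6 := hαip_pos c ⟨hc0, mc.2⟩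
      have hs0 : 0 < (1 - 0 - c) * c := mul_pos (by linarith) hc0
      have hd : 0 < δ * c := mul_pos hδ_pos hc0
      rcases n1.lt_or_eq with h | h
      · have := mul_pos h hs0
        have := mul_nonneg n2 hd.le
        linarith
      · have hp : 0 < p c := by linarith
        have := mul_nonneg n1 hs0.le
        have := mul_pos hp hd
        linarith
    obtain ⟨i, hi, hFi⟩ := intermediate_value_Ioo hc0.le hF ⟨hF0, hFc⟩
    refine ⟨i, A i, ?_, hi.1, by linarith [hs i hi.1], hFi, by linarith [hAeq i]⟩
    have h : 0 < (β - βa) * A i := by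
      rw [hAeq, ← hcβ]
      have := mul_lt_mul_of_pos_left hi.2 hβ
      linarith
    exact (mul_pos_iff_of_pos_left hb).1 h
  obtain ⟨i, a, ha, hi, hai, h1, h2⟩ := hex
  refine ⟨(a, i), ⟨ha, hi, hai, h1, by simp only [h2, zero_mul]⟩, ?_⟩
  rintro ⟨b, j⟩ ⟨hb0, hj, hbj, h3, h4⟩
  dsimp only at hb0 hj hbj h3 h4
  have h4' := (mul_eq_zero.1 h4).resolve_right hj.ne'
  have hij : j = i := by
    rcases lt_trichotomy i j with h | h | h
    · exact (key a i b j ha hi hai h1 h2 hb0 hj hbj h3 h4' h).elim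
    · exact h.symm
    · exact (key b j a i hb0 hj hbj h3 h4' ha hi hai h1 h2 h).elim
  subst hij
  have : (β - βa) * (b - a) = 0 := by linarith
  have := (mul_eq_zero.1 this).resolve_left hb.ne'
  have hab : b = a := by linarith
  rw [hab]
end

section
/- Consider the reactive SAIS model with constant rate coefficients α_i(i) = α_i, α_a(i) = α_a, p(i) = p, δ_a(i) = δ_a, and suppose β > δ. If (β − δ)/(β − β_a) < 1 − δ_a/α_a and (α_a − δ_a)/(α_a + β_a) ≥ 1 − δ/β, then the system has no interior equilibrium: there is no point (a*, i*) with a* > 0, i* > 0, a* + i* < 1 at which both right-hand sides of the system vanish. -/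
open Set Filter

theorem sais_const_no_interior_equilibrium
    (αi αa p δa β βa δ : ℝ)
    (hαi_nonneg : 0 ≤ αi) (hαa_pos : 0 < αa)
    (hp_nonneg : 0 ≤ p) (hp_le_one : p ≤ 1)
    (hαip_pos : 0 < αi + p)
    (hδa_pos : 0 < δa) (hδ_pos : 0 < δ)
    (hβa_nonneg : 0 ≤ βa) (hβaβ : βa < β)
    (hβδ : δ < β)
    (hthr : (β - δ) / (β - βa) < 1 - δa / αa)
    (hb1 : (αa - δa) / (αa + βa) ≥ 1 - δ / β) :
    ¬ ∃ e : ℝ × ℝ, 0 < e.1 ∧ 0 < e.2 ∧ e.1 + e.2 < 1 ∧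
      αi * (1 - e.1 - e.2) * (e.2) + αa * (1 - e.1 - e.2) * (e.1) + p * δ * (e.2) - βa * (e.1) * (e.2) - δa * (e.1) = 0 ∧
      (β * (1 - e.1 - e.2) + βa * (e.1) - δ) * (e.2) = 0 := by
  rintro ⟨⟨a, i⟩, ha, hi, hs, h1, h2⟩
  simp only at ha hi hs h1 h2
  have hβ : 0 < β := by linarith
  have hd : 0 < β - βa := by linarith
  have he : 0 < β - δ := by linarith
  have hline : β * (1 - a - i) + βa * a - δ = 0 := by
    rcases mul_eq_zero.mp h2 with h | h
    · exact h
    · linarith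
  obtain ⟨a0, ha0⟩ : ∃ a0, a0 = (β - δ) / (β - βa) := ⟨_, rfl⟩
  obtain ⟨i0, hi0⟩ : ∃ i0, i0 = 1 - δ / β := ⟨_, rfl⟩
  have ha0p : 0 < a0 := by rw [ha0]; positivity
  have ea : a0 * (β - βa) = β - δ := by rw [ha0]; field_simp
  have ei : i0 * β = β - δ := by rw [hi0]; field_simp
  rw [← ha0] at hthr
  rw [← hi0, ge_iff_le, le_div_iff₀ (by linarith)] at hb1
  have X : 0 < αa * (1 - a0) - δa := by
    have h := mul_lt_mul_of_pos_left hthr hαa_pos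
    have : αa * (1 - δa / αa) = αa - δa := by field_simp
    linarith
  obtain ⟨t, ht⟩ : ∃ t, t = a / a0 := ⟨_, rfl⟩
  have htp : 0 < t := by rw [ht]; positivity
  have hat : a = t * a0 := by rw [ht]; field_simp
  have hit : i = (1 - t) * i0 := by
    apply mul_left_cancel₀ hβ.ne'
    rw [hat] at hline
    linear_combination -hline - t * ea - (1 - t) * ei
  have hi0p : 0 < i0 := by
    by_contra h
    nlinarith
  have ht1 : 0 < 1 - t := by
    rw [hit] at hi
    exact (pos_iff_pos_of_mul_pos hi).mpr hi0p
  have L : 0 < αa * (1 - a) - δa - (αa + βa) * i := by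
    have e : αa * (1 - a) - δa - (αa + βa) * i
        = t * (αa * (1 - a0) - δa) + (1 - t) * (αa - δa - i0 * (αa + βa)) := by
      rw [hat, hit]; ring
    rw [e]
    have := mul_pos htp X
    have := mul_nonneg ht1.le (sub_nonneg.mpr hb1)
    linarith
  have h3 : 0 ≤ αi * (1 - a - i) * i :=
    mul_nonneg (mul_nonneg hαi_nonneg (by linarith)) hi.le
  have h4 : 0 ≤ p * δ * i := by positivity
  have h5 := mul_pos ha L
  nlinarith
end

section
/- Consider the reactive SAIS model and suppose β > δ, the functions α_i, α_a, p are nondecreasing on [0,1], δ ≥ β_a, the function δ_a is nonincreasing on [0,1], and α_a(0) > β − β_a. If (β − δ)/(β − β_a) < 1 − δ_a(0)/α_a(0), then the system has no interior equilibrium: there is no point (a*, i*) with a* > 0, i* > 0, a* + i* < 1 at which both right-hand sides of the system vanish. -/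
open Set Filter

theorem sais_no_interior_equilibrium_b2
    (αi αa p δa : ℝ → ℝ) (β βa δ : ℝ)
    (hαi_diff : DifferentiableOn ℝ αi (Set.Icc 0 1))
    (hαa_diff : DifferentiableOn ℝ αa (Set.Icc 0 1))
    (hp_diff : DifferentiableOn ℝ p (Set.Icc 0 1))
    (hδa_diff : DifferentiableOn ℝ δa (Set.Icc 0 1))
    (hαi_nonneg : ∀ x ∈ Set.Icc (0:ℝ) 1, 0 ≤ αi x)
    (hαa_nonneg : ∀ x ∈ Set.Icc (0:ℝ) 1, 0 ≤ αa x)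
    (hp_nonneg : ∀ x ∈ Set.Icc (0:ℝ) 1, 0 ≤ p x)
    (hδa_nonneg : ∀ x ∈ Set.Icc (0:ℝ) 1, 0 ≤ δa x)
    (hp_le_one : ∀ x ∈ Set.Icc (0:ℝ) 1, p x ≤ 1)
    (hδa0_pos : 0 < δa 0)
    (hαa_pos : ∀ x ∈ Set.Ioc (0:ℝ) 1, 0 < αa x)
    (hαip_pos : ∀ x ∈ Set.Ioc (0:ℝ) 1, 0 < αi x + p x)
    (hβa_nonneg : 0 ≤ βa) (hβaβ : βa < β) (hδ_pos : 0 < δ)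
    (hβδ : δ < β)
    (hαi_mono : MonotoneOn αi (Set.Icc 0 1))
    (hαa_mono : MonotoneOn αa (Set.Icc 0 1))
    (hp_mono : MonotoneOn p (Set.Icc 0 1))
    (hδβa : βa ≤ δ)
    (hδa_anti : AntitoneOn δa (Set.Icc 0 1))
    (hαa0_big : β - βa < αa 0)
    (hthr : (β - δ) / (β - βa) < 1 - δa 0 / αa 0) :
    ¬ ∃ e : ℝ × ℝ, 0 < e.1 ∧ 0 < e.2 ∧ e.1 + e.2 < 1 ∧
      αi (e.2) * (1 - e.1 - e.2) * (e.2) + αa (e.2) * (1 - e.1 - e.2) * (e.1) + p (e.2) * δ * (e.2) - βa * (e.1) * (e.2) - δa (e.2) * (e.1) = 0 ∧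
      (β * (1 - e.1 - e.2) + βa * (e.1) - δ) * (e.2) = 0 := by
  rintro ⟨⟨a, i⟩, ha, hi, hai, h1, h2⟩
  simp only at ha hi hai h1 h2
  have hiI : i ∈ Set.Icc (0:ℝ) 1 := ⟨hi.le, by linarith⟩
  have h0I : (0:ℝ) ∈ Set.Icc (0:ℝ) 1 := ⟨le_refl _, zero_le_one⟩
  have hA := hαa_mono h0I hiI hi.le
  have hd := hδa_anti h0I hiI hi.le
  have hAi := hαi_nonneg i hiI
  have hpi := hp_nonneg i hiI
  have hD : 0 < β - βa := by linarith
  have hA0 : 0 < αa 0 := by linarith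
  have h3 : β * (1 - a - i) + βa * a - δ = 0 := by
    rcases mul_eq_zero.mp h2 with h | h
    · exact h
    · linarith
  have hthr' : δa 0 * (β - βa) < αa 0 * (δ - βa) := by
    have e : (1 - δa 0 / αa 0) - (β - δ) / (β - βa)
        = (αa 0 * (δ - βa) - δa 0 * (β - βa)) / (αa 0 * (β - βa)) := by
      field_simp
      ring
    have h : 0 < (αa 0 * (δ - βa) - δa 0 * (β - βa)) / (αa 0 * (β - βa)) := by
      rw [← e]; linarith
    have := (div_pos_iff_of_pos_right (mul_pos hA0 hD)).mp h
    linarith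
  have hs : (β - βa) * (1 - a - i) = δ - βa + βa * i := by linarith
  have k1 : αa 0 * (δ - βa) ≤ αa i * (δ - βa) :=
    mul_le_mul_of_nonneg_right hA (by linarith)
  have k2 : (β - βa) * (βa * i) ≤ αa i * (βa * i) :=
    mul_le_mul_of_nonneg_right (by linarith) (by positivity)
  have k3 : 0 < (β - βa) * (αa i * (1 - a - i) - δa 0 - βa * i) := by
    have e : (β - βa) * (αa i * (1 - a - i) - δa 0 - βa * i)
        = αa i * ((β - βa) * (1 - a - i)) - δa 0 * (β - βa) - (β - βa) * (βa * i) := by ring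
    rw [e, hs]
    linarith
  have k4 := (mul_pos_iff_of_pos_left hD).mp k3
  have k5 : 0 < (αa i * (1 - a - i) - δa i - βa * i) * a :=
    mul_pos (by linarith) ha
  have hs0 : 0 ≤ 1 - a - i := by linarith
  have k6 : 0 ≤ αi i * (1 - a - i) * i := by positivity
  have k7 : 0 ≤ p i * δ * i := by positivity
  linarith
end

section
/- In the reactive SAIS model, define the rescaled vector field F₁(a,i) = f₁(a,i)/(a·i) and F₂(a,i) = f₂(a,i)/(a·i), where f₁, f₂ are the right-hand sides of the system. Then at every point (a,i) with a > 0, i > 0, a + i < 1, the divergence satisfies ∂F₁/∂a (a,i) + ∂F₂/∂i (a,i) = −(α_i(i)/a)·(1 + s/a) − α_a(i)/i − p(i)·δ/a² − β/a, where s = 1 − a − i, and in particular this divergence is strictly negative. -/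
open Set Filter

theorem sais_dulac_divergence
    (αi αa p δa : ℝ → ℝ) (β βa δ : ℝ)
    (hαi_diff : DifferentiableOn ℝ αi (Set.Icc 0 1))
    (hαa_diff : DifferentiableOn ℝ αa (Set.Icc 0 1))
    (hp_diff : DifferentiableOn ℝ p (Set.Icc 0 1))
    (hδa_diff : DifferentiableOn ℝ δa (Set.Icc 0 1))
    (hαi_nonneg : ∀ x ∈ Set.Icc (0:ℝ) 1, 0 ≤ αi x)
    (hαa_nonneg : ∀ x ∈ Set.Icc (0:ℝ) 1, 0 ≤ αa x)
    (hp_nonneg : ∀ x ∈ Set.Icc (0:ℝ) 1, 0 ≤ p x)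
    (hδa_nonneg : ∀ x ∈ Set.Icc (0:ℝ) 1, 0 ≤ δa x)
    (hp_le_one : ∀ x ∈ Set.Icc (0:ℝ) 1, p x ≤ 1)
    (hδa0_pos : 0 < δa 0)
    (hαa_pos : ∀ x ∈ Set.Ioc (0:ℝ) 1, 0 < αa x)
    (hαip_pos : ∀ x ∈ Set.Ioc (0:ℝ) 1, 0 < αi x + p x)
    (hβa_nonneg : 0 ≤ βa) (hβaβ : βa < β) (hδ_pos : 0 < δ)
    (a0 i0 : ℝ) (ha0 : 0 < a0) (hi0 : 0 < i0) (hsum : a0 + i0 < 1) :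
    deriv (fun x : ℝ => (αi (i0) * (1 - x - i0) * (i0) + αa (i0) * (1 - x - i0) * (x) + p (i0) * δ * (i0) - βa * (x) * (i0) - δa (i0) * (x)) / (x * i0)) a0
      + deriv (fun y : ℝ => ((β * (1 - a0 - y) + βa * (a0) - δ) * (y)) / (a0 * y)) i0
      = -(αi i0 / a0) * (1 + (1 - a0 - i0) / a0) - αa i0 / i0
        - p i0 * δ / a0 ^ 2 - β / a0 ∧
    -(αi i0 / a0) * (1 + (1 - a0 - i0) / a0) - αa i0 / i0
        - p i0 * δ / a0 ^ 2 - β / a0 < 0 := by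
  have ha : a0 ≠ 0 := ha0.ne'
  have hi : i0 ≠ 0 := hi0.ne'
  have hx := hasDerivAt_id' a0
  have hy := hasDerivAt_id' i0
  have h1 := (((((((hx.const_sub 1).sub_const i0).const_mul (αi i0)).mul_const i0).add
    ((((hx.const_sub 1).sub_const i0).const_mul (αa i0)).mul hx)).add_const (p i0 * δ * i0)).sub
    ((hx.const_mul βa).mul_const i0)).sub (hx.const_mul (δa i0))
  have h1' := h1.div (hx.mul_const i0) (mul_ne_zero ha hi)
  have h2 := (((((hy.const_sub (1 - a0)).const_mul β).add_const (βa * a0)).sub_const δ).mul hy).div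
    (hy.const_mul a0) (mul_ne_zero ha hi)
  have e1 := h1'.deriv
  have e2 := h2.deriv
  constructor
  · refine (congrArg₂ (· + ·) e1 e2).trans ?_
    simp only [Pi.add_apply, Pi.sub_apply, Pi.mul_apply]
    field_simp
    ring
  · have hI : i0 ∈ Set.Icc (0:ℝ) 1 := ⟨hi0.le, by linarith⟩
    have hs : 0 < 1 - a0 - i0 := by linarith
    have q1 : 0 ≤ (αi i0 / a0) * (1 + (1 - a0 - i0) / a0) := by
      have := hαi_nonneg i0 hI
      positivity
    have q2 : 0 < αa i0 / i0 := div_pos (hαa_pos i0 ⟨hi0, hI.2⟩) hi0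
    have q3 : 0 ≤ p i0 * δ / a0 ^ 2 := by
      have := hp_nonneg i0 hI
      positivity
    have q4 : 0 < β / a0 := div_pos (by linarith) ha0
    linarith
end

section
/- The reactive SAIS system has no closed orbits inside Ω: if a, i : ℝ → ℝ are differentiable functions satisfying the SAIS equations for all t ∈ ℝ, taking values in Ω = {(a,i) : a ≥ 0, i ≥ 0, a + i ≤ 1}, and periodic with some period T > 0 (a(t + T) = a(t) and i(t + T) = i(t) for all t), then a and i are constant functions. -/
open Set Filter

lemma per_deriv_zero (V V' : ℝ → ℝ) (hV : ∀ t, HasDerivAt V (V' t) t) (hn : ∀ t, 0 ≤ V' t)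
    (T : ℝ) (hT : 0 < T) (hper : ∀ t, V (t + T) = V t) : ∀ t, V' t = 0 := by
  have hm : Monotone V := monotone_of_deriv_nonneg (fun t => (hV t).differentiableAt)
    (fun t => by rw [(hV t).deriv]; exact hn t)
  intro t
  have hc : V =ᶠ[nhds t] fun _ => V (t - T/2) := by
    filter_upwards [Ioo_mem_nhds (show t - T/2 < t by linarith) (show t < t + T/2 by linarith)] with s hs
    have h1 := hm hs.1.le
    have h2 := hm hs.2.le
    have h3 := hper (t - T/2)
    rw [show t - T/2 + T = t + T/2 by ring] at h3
    linarith
  exact (hV t).unique ((hasDerivAt_const t _).congr_of_eventuallyEq hc)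

lemma const_of_deriv (f : ℝ → ℝ) (hf : ∀ t, HasDerivAt f 0 t) : ∀ t s, f t = f s :=
  is_const_of_deriv_eq_zero (fun t => (hf t).differentiableAt) (fun t => (hf t).deriv)

lemma exists_max_per (f : ℝ → ℝ) (hf : Continuous f) (T : ℝ) (hT : 0 < T)
    (hper : ∀ t, f (t + T) = f t) : ∃ t₁, ∀ t, f t ≤ f t₁ := by
  obtain ⟨t₁, -, h⟩ := (isCompact_Icc (a := (0:ℝ)) (b := T)).exists_isMaxOn
    ⟨0, by simp [hT.le]⟩ hf.continuousOn
  refine ⟨t₁, fun t => ?_⟩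
  obtain ⟨y, hy, he⟩ := Function.Periodic.exists_mem_Ico₀ (f := f) (c := T) hper hT t
  rw [he]
  exact h ⟨hy.1, hy.2.le⟩

lemma exists_prim (q : ℝ → ℝ) (m M : ℝ) (hmM : m ≤ M) (hq : ContinuousOn q (Icc m M)) :
    ∃ P : ℝ → ℝ, ∀ u ∈ Icc m M, HasDerivAt P (q u) u := by
  have hc : Continuous (IccExtend hmM ((Icc m M).domRestrict q)) :=
    (continuousOn_iff_continuous_domRestrict.mp hq).Icc_extend'
  refine ⟨fun u => ∫ x in (0:ℝ)..u, IccExtend hmM ((Icc m M).domRestrict q) x, fun u hu => ?_⟩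
  have := intervalIntegral.integral_hasDerivAt_right (hc.intervalIntegrable 0 u)
    (hc.stronglyMeasurableAtFilter _ _) hc.continuousAt
  rwa [IccExtend_of_mem hmM _ hu] at this

lemma lin_zero (f m : ℝ → ℝ) (hm : Continuous m) (hf : ∀ t, HasDerivAt f (m t * f t) t)
    (t₀ : ℝ) (h0 : f t₀ = 0) : ∀ t, f t = 0 := by
  have hM : ∀ u, HasDerivAt (fun u => ∫ x in (0:ℝ)..u, m x) (m u) u := fun u =>
    intervalIntegral.integral_hasDerivAt_right (hm.intervalIntegrable 0 u)
      (hm.stronglyMeasurableAtFilter _ _) hm.continuousAt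
  have hE : ∀ t, HasDerivAt (fun t => f t * Real.exp (-(∫ x in (0:ℝ)..t, m x))) 0 t := by
    intro t
    refine HasDerivAt.congr_deriv ((hf t).mul (hM t).neg.exp) ?_
    simp only [Pi.neg_apply]
    ring
  intro t
  have := const_of_deriv _ hE t t₀
  simp only [h0, zero_mul] at this
  exact (mul_eq_zero.mp this).resolve_right (Real.exp_pos _).ne'

theorem sais_no_closed_orbits
    (αi αa p δa : ℝ → ℝ) (β βa δ : ℝ)
    (hαi_diff : DifferentiableOn ℝ αi (Set.Icc 0 1))
    (hαa_diff : DifferentiableOn ℝ αa (Set.Icc 0 1))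
    (hp_diff : DifferentiableOn ℝ p (Set.Icc 0 1))
    (hδa_diff : DifferentiableOn ℝ δa (Set.Icc 0 1))
    (hαi_nonneg : ∀ x ∈ Set.Icc (0:ℝ) 1, 0 ≤ αi x)
    (hαa_nonneg : ∀ x ∈ Set.Icc (0:ℝ) 1, 0 ≤ αa x)
    (hp_nonneg : ∀ x ∈ Set.Icc (0:ℝ) 1, 0 ≤ p x)
    (hδa_nonneg : ∀ x ∈ Set.Icc (0:ℝ) 1, 0 ≤ δa x)
    (hp_le_one : ∀ x ∈ Set.Icc (0:ℝ) 1, p x ≤ 1)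
    (hδa0_pos : 0 < δa 0)
    (hαa_pos : ∀ x ∈ Set.Ioc (0:ℝ) 1, 0 < αa x)
    (hαip_pos : ∀ x ∈ Set.Ioc (0:ℝ) 1, 0 < αi x + p x)
    (hβa_nonneg : 0 ≤ βa) (hβaβ : βa < β) (hδ_pos : 0 < δ)
    (a i : ℝ → ℝ)
    (hda : ∀ t : ℝ, HasDerivAt a (αi (i t) * (1 - a t - i t) * (i t) + αa (i t) * (1 - a t - i t) * (a t) + p (i t) * δ * (i t) - βa * (a t) * (i t) - δa (i t) * (a t)) t)
    (hdi : ∀ t : ℝ, HasDerivAt i ((β * (1 - a t - i t) + βa * (a t) - δ) * (i t)) t)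
    (hΩ : ∀ t : ℝ, 0 ≤ a t ∧ 0 ≤ i t ∧ a t + i t ≤ 1)
    (T : ℝ) (hT : 0 < T)
    (hper : ∀ t : ℝ, a (t + T) = a t ∧ i (t + T) = i t) :
    ∀ t s : ℝ, a t = a s ∧ i t = i s := by
  have hβ : 0 < β := by linarith
  have hc : 0 < β - βa := by linarith
  have hac : Continuous a := continuous_iff_continuousAt.mpr fun t => (hda t).continuousAt
  have hic : Continuous i := continuous_iff_continuousAt.mpr fun t => (hdi t).continuousAt
  by_cases hz : ∃ t₀, i t₀ = 0
  · obtain ⟨t₀, ht₀⟩ := hz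
    have hi0 : ∀ t, i t = 0 := lin_zero i _ (by fun_prop) hdi t₀ ht₀
    have hda' : ∀ t, HasDerivAt a (αa 0 * (1 - a t) * a t - δa 0 * a t) t := by
      intro t
      convert hda t using 1
      rw [hi0 t]; ring
    have hV : ∀ t, HasDerivAt (fun t => (αa 0 - δa 0) * (a t)^2 / 2 - αa 0 * (a t)^3 / 3)
        ((αa 0 * (1 - a t) * a t - δa 0 * a t)^2) t := by
      intro t
      have h := hda' t
      refine HasDerivAt.congr_deriv ((((h.pow 2).const_mul (αa 0 - δa 0)).div_const 2).sub
        (((h.pow 3).const_mul (αa 0)).div_const 3)) ?_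
      push_cast
      ring
    have h0 := per_deriv_zero _ _ hV (fun t => sq_nonneg _) T hT (fun t => by simp only [(hper t).1])
    have ha0 : ∀ t, HasDerivAt a 0 t := fun t => by
      have h := hda' t
      rwa [pow_eq_zero_iff (two_ne_zero)|>.mp (h0 t)] at h
    exact fun t s => ⟨const_of_deriv a ha0 t s, by rw [hi0, hi0]⟩
  push Not at hz
  have hip : ∀ t, 0 < i t := fun t => lt_of_le_of_ne (hΩ t).2.1 (hz t).symm
  have hi1 : ∀ t, i t ≤ 1 := fun t => by linarith [(hΩ t).1, (hΩ t).2.2]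
  have hap : ∀ t, 0 < a t := by
    intro t
    refine lt_of_le_of_ne (hΩ t).1 fun h0 => ?_
    have hmin : IsLocalMin a t := Eventually.of_forall fun s => by
      change a t ≤ a s
      rw [← h0]; exact (hΩ s).1
    have hd := hmin.hasDerivAt_eq_zero (hda t)
    rw [← h0] at hd
    have hmem : i t ∈ Icc (0:ℝ) 1 := ⟨(hip t).le, hi1 t⟩
    have hA := hαi_nonneg _ hmem
    have hP := hp_nonneg _ hmem
    have hS := hαip_pos (i t) ⟨hip t, hi1 t⟩
    have e1 : 0 ≤ αi (i t) * (1 - i t) := mul_nonneg hA (by linarith [hi1 t])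
    have e2 : 0 ≤ p (i t) * δ := mul_nonneg hP hδ_pos.le
    have e3 : (αi (i t) * (1 - i t) + p (i t) * δ) * i t = 0 := by linarith
    have e4 := (mul_eq_zero.mp e3).resolve_right (hip t).ne'
    have e5 : p (i t) = 0 := (mul_eq_zero.mp (by linarith : p (i t) * δ = 0)).resolve_right hδ_pos.ne'
    have e6 : 1 - i t = 0 :=
      (mul_eq_zero.mp (by linarith : αi (i t) * (1 - i t) = 0)).resolve_left (by linarith)
    have e7 : i t = 1 := by linarith
    have hmax : IsLocalMax i t := Eventually.of_forall fun s => by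
      change i s ≤ i t
      rw [e7]; exact hi1 s
    have hd2 := hmax.hasDerivAt_eq_zero (hdi t)
    rw [← h0, e7] at hd2
    linarith
  obtain ⟨t₁, ht₁⟩ := exists_max_per i hic T hT (fun t => (hper t).2)
  obtain ⟨t₂, ht₂⟩ := exists_max_per (fun t => - i t) hic.neg T hT (fun t => by simp only [(hper t).2])
  set g : ℝ → ℝ := fun x => β - δ - β * x with hg
  have hgM : g (i t₁) = (β - βa) * a t₁ := by
    have hmax : IsLocalMax i t₁ := Eventually.of_forall ht₁
    have h := (mul_eq_zero.mp (hmax.hasDerivAt_eq_zero (hdi t₁))).resolve_right (hip t₁).ne'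
    simp only [hg]; linarith
  have hgpos : ∀ x ∈ Icc (i t₂) (i t₁), 0 < g x := by
    intro x hx
    have h1 : 0 < g (i t₁) := by rw [hgM]; exact mul_pos hc (hap _)
    have h2 : β * x ≤ β * i t₁ := mul_le_mul_of_nonneg_left hx.2 hβ.le
    simp only [hg] at h1 ⊢; linarith
  set h : ℝ → ℝ → ℝ := fun x y => αi x * ((1 - x) / y - 1) * x + αa x * (1 - y - x)
    + p x * δ * x / y - βa * x - δa x with hh
  have hsub : Icc (i t₂) (i t₁) ⊆ Icc (0:ℝ) 1 := Icc_subset_Icc (hip _).le (hi1 _)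
  have hqc : ContinuousOn (fun x => h x (g x / (β - βa)) / x - β * Real.log (g x / (β - βa)))
      (Icc (i t₂) (i t₁)) := by
    have c1 := hαi_diff.continuousOn.mono hsub
    have c2 := hαa_diff.continuousOn.mono hsub
    have c3 := hp_diff.continuousOn.mono hsub
    have c4 := hδa_diff.continuousOn.mono hsub
    have c5 : ContinuousOn (fun x => g x / (β - βa)) (Icc (i t₂) (i t₁)) := by
      simp only [hg]; fun_prop
    have n5 : ∀ x ∈ Icc (i t₂) (i t₁), g x / (β - βa) ≠ 0 := fun x hx => (div_pos (hgpos x hx) hc).ne'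
    have c6 : ContinuousOn (fun x : ℝ => x) (Icc (i t₂) (i t₁)) := continuousOn_id
    have c7 : ContinuousOn (fun x => h x (g x / (β - βa))) (Icc (i t₂) (i t₁)) := by
      simp only [hh]
      exact (((((c1.mul (((continuousOn_const.sub c6).div c5 n5).sub continuousOn_const)).mul c6).add
        (c2.mul ((continuousOn_const.sub c5).sub c6))).add
        (((c3.mul continuousOn_const).mul c6).div c5 n5)).sub (continuousOn_const.mul c6)).sub c4
    exact (c7.div c6 fun x hx => ((hip t₂).trans_le hx.1).ne').sub
      (continuousOn_const.mul (c5.log n5))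
  obtain ⟨P, hP⟩ := exists_prim _ _ _ (ht₁ t₂) hqc
  have hmem : ∀ t, i t ∈ Icc (i t₂) (i t₁) := fun t => ⟨by linarith [ht₂ t], ht₁ t⟩
  have hV : ∀ t, HasDerivAt (fun t => g (i t) * Real.log (a t) - (β - βa) * a t - P (i t))
      (β * i t * ((g (i t) - (β - βa) * a t) * (Real.log (g (i t) / (β - βa)) - Real.log (a t)))
        + (g (i t) - (β - βa) * a t) * (h (i t) (a t) - h (i t) (g (i t) / (β - βa)))) t := by
    intro t
    have hat := (hap t).ne'
    have hit := (hip t).ne'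
    have d1 : HasDerivAt i ((g (i t) - (β - βa) * a t) * i t) t := by
      convert hdi t using 1
      simp only [hg]; ring
    have d2 : HasDerivAt a (a t * h (i t) (a t)) t := by
      convert hda t using 1
      simp only [hh]; field_simp; ring
    have d3 : HasDerivAt (fun t => g (i t)) (-(β * ((g (i t) - (β - βa) * a t) * i t))) t := by
      simpa only [hg] using (d1.const_mul β).const_sub (β - δ)
    have d4 := (hP _ (hmem t)).comp t d1
    refine HasDerivAt.congr_deriv (((d3.mul (d2.log hat)).sub (d2.const_mul (β - βa))).sub d4) ?_
    generalize h (i t) (a t) = H1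
    generalize h (i t) (g (i t) / (β - βa)) = H2
    generalize Real.log (g (i t) / (β - βa)) = L2
    generalize Real.log (a t) = L1
    field_simp
    ring
  have hn1 : ∀ t, 0 ≤ (g (i t) - (β - βa) * a t) * (h (i t) (a t) - h (i t) (g (i t) / (β - βa))) := by
    intro t
    have hat := hap t
    have hb : 0 < g (i t) / (β - βa) := div_pos (hgpos _ (hmem t)) hc
    have hgb : g (i t) = (β - βa) * (g (i t) / (β - βa)) := by field_simp
    have hm := hsub (hmem t)
    have hA := hαi_nonneg _ hm
    have hAa := hαa_nonneg _ hm
    have hpp := hp_nonneg _ hm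
    generalize g (i t) / (β - βa) = b at *
    have e : (g (i t) - (β - βa) * a t) * (h (i t) (a t) - h (i t) b) =
      (β - βa) * (b - a t)^2 * ((αi (i t) * (1 - i t) * i t + p (i t) * δ * i t) / (a t * b) + αa (i t)) := by
      rw [hgb]; simp only [hh]; field_simp; ring
    rw [e]
    have : 0 ≤ 1 - i t := by linarith [hi1 t]
    have := hip t
    positivity
  have hn2 : ∀ t, 0 ≤ (g (i t) - (β - βa) * a t) * (Real.log (g (i t) / (β - βa)) - Real.log (a t)) ∧
      ((g (i t) - (β - βa) * a t) * (Real.log (g (i t) / (β - βa)) - Real.log (a t)) = 0 →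
        g (i t) - (β - βa) * a t = 0) := by
    intro t
    have hat := hap t
    have hb : 0 < g (i t) / (β - βa) := div_pos (hgpos _ (hmem t)) hc
    have hgb : g (i t) = (β - βa) * (g (i t) / (β - βa)) := by field_simp
    generalize g (i t) / (β - βa) = b at *
    rw [hgb, ← mul_sub]
    rcases lt_trichotomy (a t) b with hl | hl | hl
    · have := mul_pos (mul_pos hc (sub_pos.mpr hl)) (sub_pos.mpr (Real.log_lt_log hat hl))
      exact ⟨this.le, fun h => absurd h this.ne'⟩
    · simp [hl]
    · have := mul_pos_of_neg_of_neg (mul_neg_of_pos_of_neg hc (sub_neg.mpr hl)) (sub_neg.mpr (Real.log_lt_log hb hl))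
      exact ⟨this.le, fun h => absurd h this.ne'⟩
  have h0 := per_deriv_zero _ _ hV
    (fun t => add_nonneg (mul_nonneg (mul_pos hβ (hip t)).le (hn2 t).1) (hn1 t)) T hT
    (fun t => by simp only [(hper t).1, (hper t).2])
  have hk : ∀ t, g (i t) - (β - βa) * a t = 0 := by
    intro t
    apply (hn2 t).2
    have e1 := mul_nonneg (mul_pos hβ (hip t)).le (hn2 t).1
    have e2 := hn1 t
    have e3 := h0 t
    exact (mul_eq_zero.mp (by linarith)).resolve_left (mul_pos hβ (hip t)).ne'
  have hi' : ∀ t, HasDerivAt i 0 t := by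
    intro t
    convert hdi t using 1
    have := hk t
    simp only [hg] at this
    rw [show β * (1 - a t - i t) + βa * a t - δ = 0 by linarith, zero_mul]
  intro t s
  have hts := const_of_deriv i hi' t s
  refine ⟨?_, hts⟩
  have e1 := hk t
  have e2 := hk s
  rw [hts] at e1
  exact mul_left_cancel₀ hc.ne' (by linarith)
end

section
/- Consider the reactive SAIS model and suppose β ≤ δ and α_a(0) ≤ δ_a(0). Then (0,0) is the only equilibrium point of the system in Ω (i.e., the only point of Ω at which both right-hand sides vanish), and (0,0) is globally asymptotically stable on Ω: every differentiable solution (a(t), i(t)) of the system defined for t ≥ 0 with (a(0), i(0)) ∈ Ω converges to (0,0) as t → ∞. -/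
open Set Filter

theorem aux_nonneg (u u' g : ℝ → ℝ) (T : ℝ)
    (hu : ∀ t ∈ Icc (0:ℝ) T, HasDerivAt u (u' t) t)
    (hg : ContinuousOn g (Icc 0 T))
    (h : ∀ t ∈ Icc (0:ℝ) T, g t * u t ≤ u' t) (h0 : 0 ≤ u 0) :
    ∀ t ∈ Icc (0:ℝ) T, 0 ≤ u t := by
  obtain ⟨K, hK⟩ := (isCompact_Icc.image_of_continuousOn hg).bddAbove
  have hK' : ∀ t ∈ Icc (0:ℝ) T, g t ≤ K := fun t ht => hK ⟨t, ht, rfl⟩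
  intro t ht
  have key : ∀ ε > 0, - u t ≤ ε * Real.exp ((K+1) * t) := by
    intro ε hε
    have hB : ∀ x, HasDerivAt (fun x => ε * Real.exp ((K+1) * x))
        (ε * (Real.exp ((K+1) * x) * ((K+1) * 1))) x := fun x =>
      (((hasDerivAt_id x).const_mul (K+1)).exp).const_mul ε
    refine image_le_of_deriv_right_lt_deriv_boundary (f := fun x => - u x) (f' := fun x => - u' x)
      (a := 0) (b := T) ?_ ?_ ?_ hB ?_ ht
    · exact fun x hx => (hu x hx).neg.continuousAt.continuousWithinAt
    · exact fun x hx => (hu x (Ico_subset_Icc_self hx)).neg.hasDerivWithinAt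
    · simp; linarith
    · intro x hx hx2
      have h1 := h x (Ico_subset_Icc_self hx)
      have h2 := hK' x (Ico_subset_Icc_self hx)
      have h3 : 0 < ε * Real.exp ((K+1) * x) := by positivity
      have e : ε * (Real.exp ((K+1) * x) * ((K+1) * 1)) = (K+1) * (- u x) := by
        rw [hx2]; ring
      rw [e]
      rw [← hx2] at h3
      nlinarith
  by_contra hneg
  push Not at hneg
  have hE : 0 < Real.exp ((K+1) * t) := Real.exp_pos _
  have := key (- u t / (2 * Real.exp ((K+1) * t))) (by apply div_pos; linarith; positivity)
  have e : - u t / (2 * Real.exp ((K+1) * t)) * Real.exp ((K+1) * t) = - u t / 2 := by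
    field_simp
  rw [e] at this
  linarith

theorem aux_tendsto (u u' e : ℝ → ℝ) (c : ℝ) (hc : 0 < c)
    (hu : ∀ t, 0 ≤ t → HasDerivAt u (u' t) t)
    (hpos : ∀ t, 0 ≤ t → 0 ≤ u t)
    (h : ∀ t, 0 ≤ t → u' t ≤ - c * (u t)^2 + e t)
    (he : Tendsto e atTop (nhds 0)) : Tendsto u atTop (nhds 0) := by
  rw [Metric.tendsto_atTop]
  intro r hr
  obtain ⟨η, hη, hηr⟩ := exists_between hr
  have hk : 0 < c * η^2 / 2 := by positivity
  obtain ⟨T0, hT0⟩ := eventually_atTop.1 (he.eventually (gt_mem_nhds hk))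
  set T := max T0 0
  have hTn : 0 ≤ T := le_max_right _ _
  have hd : ∀ t, T ≤ t → η ≤ u t → u' t ≤ - (c * η^2 / 2) := by
    intro t ht hut
    have h1 := h t (hTn.trans ht)
    have h2 := hT0 t ((le_max_left _ _).trans ht)
    have h3 : η^2 ≤ (u t)^2 := by gcongr
    nlinarith
  have hex : ∃ t1, T ≤ t1 ∧ u t1 ≤ η := by
    by_contra hcon
    push Not at hcon
    set k := c * η^2 / 2
    set b := T + (u T + 1) / k
    have huT := hpos T hTn
    have hTb : T ≤ b := by
      have : 0 ≤ (u T + 1) / k := by positivity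
      simp only [b]; linarith
    have := image_le_of_deriv_right_le_deriv_boundary (f := u) (f' := u') (a := T) (b := b)
      (B := fun x => u T - k * (x - T)) (B' := fun x => - k)
      (fun x hx => (hu x (hTn.trans hx.1)).continuousAt.continuousWithinAt)
      (fun x hx => (hu x (hTn.trans hx.1)).hasDerivWithinAt) (by simp) (by fun_prop)
      (fun x hx => by
        have := (((hasDerivAt_id x).sub_const T).const_mul k).const_sub (u T)
        simpa using this.hasDerivWithinAt)
      (fun x hx => hd x hx.1 (hcon x hx.1).le) (right_mem_Icc.2 hTb)
    have e1 : k * (b - T) = u T + 1 := by simp only [b]; field_simp; ring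
    have := hpos b (hTn.trans hTb)
    linarith
  obtain ⟨t1, ht1, hut1⟩ := hex
  refine ⟨t1, fun t ht => ?_⟩
  have := image_le_of_deriv_right_lt_deriv_boundary (f := u) (f' := u') (a := t1) (b := t)
    (B := fun _ => η) (B' := fun _ => 0)
    (fun x hx => (hu x (hTn.trans (ht1.trans hx.1))).continuousAt.continuousWithinAt)
    (fun x hx => (hu x (hTn.trans (ht1.trans hx.1))).hasDerivWithinAt) hut1
    (fun x => hasDerivAt_const x η)
    (fun x hx hx2 => by
      have := hd x (ht1.trans hx.1) hx2.ge
      linarith) (right_mem_Icc.2 ht)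
  have h0 := hpos t (hTn.trans (ht1.trans ht))
  rw [Real.dist_eq, sub_zero, abs_of_nonneg h0]
  linarith


theorem sais_P1_global_stability
    (αi αa p δa : ℝ → ℝ) (β βa δ : ℝ)
    (hαi_diff : DifferentiableOn ℝ αi (Set.Icc 0 1))
    (hαa_diff : DifferentiableOn ℝ αa (Set.Icc 0 1))
    (hp_diff : DifferentiableOn ℝ p (Set.Icc 0 1))
    (hδa_diff : DifferentiableOn ℝ δa (Set.Icc 0 1))
    (hαi_nonneg : ∀ x ∈ Set.Icc (0:ℝ) 1, 0 ≤ αi x)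
    (hαa_nonneg : ∀ x ∈ Set.Icc (0:ℝ) 1, 0 ≤ αa x)
    (hp_nonneg : ∀ x ∈ Set.Icc (0:ℝ) 1, 0 ≤ p x)
    (hδa_nonneg : ∀ x ∈ Set.Icc (0:ℝ) 1, 0 ≤ δa x)
    (hp_le_one : ∀ x ∈ Set.Icc (0:ℝ) 1, p x ≤ 1)
    (hδa0_pos : 0 < δa 0)
    (hαa_pos : ∀ x ∈ Set.Ioc (0:ℝ) 1, 0 < αa x)
    (hαip_pos : ∀ x ∈ Set.Ioc (0:ℝ) 1, 0 < αi x + p x)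
    (hβa_nonneg : 0 ≤ βa) (hβaβ : βa < β) (hδ_pos : 0 < δ)
    (hR0 : β ≤ δ) (hR0a : αa 0 ≤ δa 0) :
    (∀ a0 i0 : ℝ, 0 ≤ a0 → 0 ≤ i0 → a0 + i0 ≤ 1 →
      αi (i0) * (1 - a0 - i0) * (i0) + αa (i0) * (1 - a0 - i0) * (a0) + p (i0) * δ * (i0) - βa * (a0) * (i0) - δa (i0) * (a0) = 0 →
      (β * (1 - a0 - i0) + βa * (a0) - δ) * (i0) = 0 →
      a0 = 0 ∧ i0 = 0) ∧
    (∀ a i : ℝ → ℝ,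
      (∀ t : ℝ, 0 ≤ t → HasDerivAt a (αi (i t) * (1 - a t - i t) * (i t) + αa (i t) * (1 - a t - i t) * (a t) + p (i t) * δ * (i t) - βa * (a t) * (i t) - δa (i t) * (a t)) t) →
      (∀ t : ℝ, 0 ≤ t → HasDerivAt i ((β * (1 - a t - i t) + βa * (a t) - δ) * (i t)) t) →
      0 ≤ a 0 → 0 ≤ i 0 → a 0 + i 0 ≤ 1 →
      Filter.Tendsto (fun t => (a t, i t)) Filter.atTop (nhds ((0:ℝ), (0:ℝ)))) := by
  have hβ : 0 < β := by linarith
  have m0 : (0:ℝ) ∈ Icc (0:ℝ) 1 := by simp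
  constructor
  · intro a0 i0 ha hi hai h1 h2
    have hi0 : i0 = 0 := by
      by_contra hne
      have hip : 0 < i0 := lt_of_le_of_ne hi (Ne.symm hne)
      have h3 := (mul_eq_zero.1 h2).resolve_right hne
      nlinarith [mul_pos hβ hip, mul_nonneg (sub_nonneg.2 hβaβ.le) ha]
    subst hi0
    refine ⟨?_, rfl⟩
    by_contra hne
    have hap : 0 < a0 := lt_of_le_of_ne ha (Ne.symm hne)
    have h4 : (αa 0 * (1 - a0) - δa 0) * a0 = 0 := by linear_combination h1
    have h5 := (mul_eq_zero.1 h4).resolve_right hne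
    have h6 : αa 0 * (1 - a0) ≤ δa 0 * (1 - a0) :=
      mul_le_mul_of_nonneg_right hR0a (by linarith)
    nlinarith [mul_pos hδa0_pos hap]
  · intro a i ha hi ha0 hi0 hai0
    have cai : ∀ T, ContinuousOn a (Icc 0 T) := fun T t ht =>
      (ha t ht.1).continuousAt.continuousWithinAt
    have cii : ∀ T, ContinuousOn i (Icc 0 T) := fun T t ht =>
      (hi t ht.1).continuousAt.continuousWithinAt
    have ipos : ∀ t, 0 ≤ t → 0 ≤ i t := by
      intro T hT
      refine aux_nonneg i _ (fun t => β * (1 - a t - i t) + βa * (a t) - δ) T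
        (fun t ht => hi t ht.1) ?_ (fun t ht => le_rfl) hi0 T (right_mem_Icc.2 hT)
      have := cai T
      have := cii T
      fun_prop
    have inv : ∀ T, 0 ≤ T → (∀ t ∈ Icc 0 T, i t ≤ 1) → 0 ≤ a T ∧ 0 ≤ 1 - a T - i T := by
      intro T hT hT1
      have c1 := cai T
      have c2 := cii T
      have mp : MapsTo i (Icc 0 T) (Icc 0 1) := fun t ht => ⟨ipos t ht.1, hT1 t ht⟩
      have d1 : ContinuousOn (fun t => αi (i t)) (Icc 0 T) := hαi_diff.continuousOn.comp c2 mp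
      have d2 : ContinuousOn (fun t => αa (i t)) (Icc 0 T) := hαa_diff.continuousOn.comp c2 mp
      have d4 : ContinuousOn (fun t => δa (i t)) (Icc 0 T) := hδa_diff.continuousOn.comp c2 mp
      have apos : ∀ t ∈ Icc 0 T, 0 ≤ a t := by
        refine aux_nonneg a _ (fun t => - αi (i t) * i t + αa (i t) * (1 - a t - i t)
          - βa * i t - δa (i t)) T (fun t ht => ha t ht.1)
          ((((d1.neg.mul c2).add (d2.mul ((continuousOn_const.sub c1).sub c2))).sub
            (continuousOn_const.mul c2)).sub d4) ?_ ha0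
        intro t ht
        have e1 := hαi_nonneg _ (mp ht)
        have e2 := hp_nonneg _ (mp ht)
        have e3 := (mp ht).1
        have e4 := (mp ht).2
        have e5 : 0 ≤ αi (i t) * (1 - i t) * i t :=
          mul_nonneg (mul_nonneg e1 (by linarith)) e3
        have e6 : 0 ≤ p (i t) * δ * i t := by positivity
        linarith
      refine ⟨apos T (right_mem_Icc.2 hT), ?_⟩
      refine aux_nonneg (fun t => 1 - a t - i t) _ (fun t => - αi (i t) * i t - αa (i t) * a t
          - β * i t) T (fun t ht => ((ha t ht.1).const_sub 1).sub (hi t ht.1))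
          (((d1.neg.mul c2).sub (d2.mul c1)).sub (continuousOn_const.mul c2)) ?_ (by linarith) T (right_mem_Icc.2 hT)
      intro t ht
      have e1 := hδa_nonneg _ (mp ht)
      have e2 := hp_le_one _ (mp ht)
      have e3 := (mp ht).1
      have e4 := apos t ht
      have e5 : 0 ≤ (1 - p (i t)) * δ * i t :=
          mul_nonneg (mul_nonneg (by linarith) hδ_pos.le) e3
      have e6 : 0 ≤ δa (i t) * a t := by positivity
      linarith
    have ile : ∀ t, 0 ≤ t → i t ≤ 1 := by
      by_contra hcon
      push Not at hcon
      obtain ⟨t1, ht1, hit1⟩ := hcon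
      set S : Set ℝ := {t | 0 ≤ t ∧ 1 < i t}
      have hSne : S.Nonempty := ⟨t1, ht1, hit1⟩
      have hSb : BddBelow S := ⟨0, fun t ht => ht.1⟩
      set T := sInf S
      have hT : 0 ≤ T := le_csInf hSne fun t ht => ht.1
      have hlt : ∀ t, 0 ≤ t → t < T → i t ≤ 1 := by
        intro t h0 hlt
        by_contra hc
        push Not at hc
        exact absurd (csInf_le hSb (show t ∈ S from ⟨h0, hc⟩)) (not_le.2 hlt)
      have hiT : i T ≤ 1 := by
        by_contra hc
        push Not at hc
        have hT0 : 0 < T := by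
          rcases hT.eq_or_lt with h | h
          · rw [← h] at hc; linarith
          · exact h
        have ev : ∀ᶠ t in nhdsWithin T (Iio T), 1 < i t :=
          ((hi T hT).continuousAt.eventually (lt_mem_nhds hc)).filter_mono nhdsWithin_le_nhds
        have ev2 : ∀ᶠ t in nhdsWithin T (Iio T), 0 < t :=
          (lt_mem_nhds hT0).filter_mono nhdsWithin_le_nhds
        obtain ⟨t, h1, h2, h3⟩ := (ev.and (ev2.and self_mem_nhdsWithin)).exists
        have := hlt t h2.le h3
        linarith
      have hle : ∀ t ∈ Icc 0 T, i t ≤ 1 := by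
        intro t ht
        rcases ht.2.eq_or_lt with h | h
        · rw [h]; exact hiT
        · exact hlt t ht.1 h
      obtain ⟨g1, g2⟩ := inv T hT hle
      have ev : ∀ᶠ t in nhdsWithin T (Ioi T), i t ≤ 1 := by
        rcases hiT.eq_or_lt with h | h
        · have haT : a T = 0 := by linarith
          have hd := hi T hT
          rw [h, haT] at hd
          have hd2 := hd.hasDerivWithinAt (s := Ioi T)
          rw [hasDerivWithinAt_iff_tendsto_slope' (by simp)] at hd2
          filter_upwards [hd2.eventually (gt_mem_nhds (show _ < (0:ℝ) by linarith)),
            self_mem_nhdsWithin] with t h1 h2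
          rw [slope_def_field, h] at h1
          have h2' : 0 < t - T := sub_pos.2 h2
          have := (div_neg_iff.1 h1)
          rcases this with h | h <;> linarith [h.1, h.2]
        · exact (((hi T hT).continuousAt.eventually (gt_mem_nhds h)).filter_mono
            nhdsWithin_le_nhds).mono fun t ht => ht.le
      obtain ⟨y, hy, hyT⟩ := (mem_nhdsGT_iff_exists_Ioo_subset).1 ev
      obtain ⟨t, htS, hty⟩ := exists_lt_of_csInf_lt hSne (show sInf S < y from hy)
      have hTt : T ≤ t := csInf_le hSb htS
      rcases hTt.eq_or_lt with h | h
      · have := htS.2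
        rw [← h] at this; linarith
      · have h1 : i t ≤ 1 := hyT ⟨h, hty⟩
        linarith [htS.2]
    have inv' : ∀ t, 0 ≤ t → 0 ≤ a t ∧ 0 ≤ 1 - a t - i t := fun t ht =>
      inv t ht fun x hx => ile x hx.1
    have mi : ∀ t, 0 ≤ t → i t ∈ Icc (0:ℝ) 1 := fun t ht => ⟨ipos t ht, ile t ht⟩
    have ti : Tendsto i atTop (nhds 0) := by
      refine aux_tendsto i _ (fun _ => 0) β hβ hi ipos ?_ tendsto_const_nhds
      intro t ht
      have h1 := ipos t ht
      have h2 := (inv' t ht).1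
      have h3 : 0 ≤ (β - βa) * a t * i t := by
        have := sub_pos.2 hβaβ; positivity
      have h4 : 0 ≤ (δ - β) * i t := mul_nonneg (by linarith) h1
      nlinarith
    have tw : Tendsto i atTop (nhdsWithin 0 (Icc 0 1)) :=
      tendsto_nhdsWithin_iff.2 ⟨ti, (eventually_ge_atTop 0).mono mi⟩
    have t1 := (hαi_diff.continuousOn 0 m0).tendsto.comp tw
    have t2 := (hαa_diff.continuousOn 0 m0).tendsto.comp tw
    have t4 := (hδa_diff.continuousOn 0 m0).tendsto.comp tw
    have ta : Tendsto a atTop (nhds 0) := by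
      refine aux_tendsto a _ (fun t => αi (i t) * i t + δ * i t + |αa (i t) - αa 0|
        + |δa (i t) - δa 0|) (δa 0) hδa0_pos ha (fun t ht => (inv' t ht).1) ?_ ?_
      · intro t ht
        obtain ⟨h1, h2⟩ := inv' t ht
        have h3 := ipos t ht
        have h4 := ile t ht
        have e1 := hαi_nonneg _ (mi t ht)
        have e2 := hαa_nonneg _ (mi t ht)
        have e3 := hp_le_one _ (mi t ht)
        have b1 : αi (i t) * (1 - a t - i t) * i t ≤ αi (i t) * i t := by
          have : 0 ≤ αi (i t) * i t * (a t + i t) := by positivity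
          linarith
        have b2 : p (i t) * δ * i t ≤ δ * i t := by
          have : 0 ≤ (1 - p (i t)) * (δ * i t) := mul_nonneg (by linarith) (by positivity)
          linarith
        have b3 : 0 ≤ βa * a t * i t := by positivity
        have b4 : αa (i t) * (1 - a t - i t) * a t ≤
            αa 0 * (1 - a t) * a t + |αa (i t) - αa 0| := by
          have c1 : 0 ≤ αa (i t) * i t * a t := by positivity
          have c2 : (αa (i t) - αa 0) * ((1 - a t) * a t) ≤ |αa (i t) - αa 0| * 1 := by
            have q0 : 0 ≤ (1 - a t) * a t := mul_nonneg (by linarith) h1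
            refine (mul_le_mul_of_nonneg_right (le_abs_self _) q0).trans ?_
            exact mul_le_mul_of_nonneg_left (by nlinarith) (abs_nonneg _)
          linarith
        have b5 : - (δa (i t) * a t) ≤ - (δa 0 * a t) + |δa (i t) - δa 0| := by
          have c2 : -(δa (i t) - δa 0) * a t ≤ |δa (i t) - δa 0| * 1 := by
            refine (mul_le_mul_of_nonneg_right (neg_le_abs _) h1).trans ?_
            exact mul_le_mul_of_nonneg_left (by linarith) (abs_nonneg _)
          linarith
        have b6 : 0 ≤ (δa 0 - αa 0) * ((1 - a t) * a t) :=
          mul_nonneg (by linarith) (mul_nonneg (by linarith) h1)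
        linarith
      · have := (((t1.mul ti).add (ti.const_mul δ)).add (t2.sub_const (αa 0)).abs).add
          (t4.sub_const (δa 0)).abs
        simpa using this
    exact ta.prodMk_nhds ti
end

section
/- Consider the reactive SAIS model and suppose β ≤ δ and α_a(0) > δ_a(0). Then the only equilibrium points of the system in Ω are P₁ = (0,0) and P₂ = (1 − δ_a(0)/α_a(0), 0), and P₂ is globally asymptotically stable on Ω ∖ {P₁}: every differentiable solution (a(t), i(t)) of the system defined for t ≥ 0 with (a(0), i(0)) ∈ Ω and (a(0), i(0)) ≠ (0,0) converges to P₂ as t → ∞. -/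
open Set Filter

lemma aux_gron (W W' : ℝ → ℝ) (C a b : ℝ)
    (h : ∀ t ∈ Icc a b, HasDerivAt W (W' t) t)
    (hb : ∀ t ∈ Icc a b, W' t ≤ C * W t) :
    ∀ t ∈ Icc a b, W t ≤ W a * Real.exp (C * (t - a)) := by
  intro t ht
  have hd : ∀ x ∈ Icc a b, HasDerivAt (fun x => W x * Real.exp (-(C * (x - a))))
      (W' x * Real.exp (-(C * (x - a))) + W x * (Real.exp (-(C * (x - a))) * (-(C * 1)))) x := by
    intro x hx
    have h1 : HasDerivAt (fun x : ℝ => -(C * (x - a))) (-(C * 1)) x :=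
      (((hasDerivAt_id x).sub_const a).const_mul C).neg
    exact (h x hx).mul h1.exp
  have hanti : AntitoneOn (fun x => W x * Real.exp (-(C * (x - a)))) (Icc a b) := by
    apply antitoneOn_of_deriv_nonpos (convex_Icc a b)
    · exact fun x hx => (hd x hx).continuousAt.continuousWithinAt
    · intro x hx
      exact (hd x (interior_subset hx)).differentiableAt.differentiableWithinAt
    · intro x hx
      have hx' := interior_subset hx
      rw [(hd x hx').deriv]
      have := hb x hx'
      have he := Real.exp_pos (-(C * (x - a)))
      nlinarith
  have := hanti (left_mem_Icc.2 (ht.1.trans ht.2)) ht ht.1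
  simp only [sub_self, mul_zero, neg_zero, Real.exp_zero, mul_one] at this
  rw [Real.exp_neg] at this
  have he := Real.exp_pos (C * (t - a))
  rwa [← div_eq_mul_inv, div_le_iff₀ he] at this

lemma aux_event (u u' : ℝ → ℝ) (T c m : ℝ) (hc : 0 < c)
    (h : ∀ t, T ≤ t → HasDerivAt u (u' t) t)
    (hb : ∀ t, T ≤ t → m ≤ u t → u' t ≤ -c) :
    ∀ᶠ t in atTop, u t ≤ m := by
  have hex : ∃ t1, T ≤ t1 ∧ u t1 ≤ m := by
    by_contra hcon
    push Not at hcon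
    set x := T + (u T - m) / c with hx
    have hTm := hcon T le_rfl
    have hTx : T ≤ x := by
      have : 0 ≤ (u T - m) / c := div_nonneg (by linarith) hc.le
      linarith
    have hd : ∀ y ∈ Icc T x, HasDerivAt (fun y => u y + c * y) (u' y + c * 1) y := fun y hy =>
      (h y hy.1).add ((hasDerivAt_id y).const_mul c)
    have hanti : AntitoneOn (fun y => u y + c * y) (Icc T x) := by
      apply antitoneOn_of_deriv_nonpos (convex_Icc T x)
      · exact fun y hy => (hd y hy).continuousAt.continuousWithinAt
      · intro y hy
        exact (hd y (interior_subset hy)).differentiableAt.differentiableWithinAt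
      · intro y hy
        have hy' := interior_subset hy
        rw [(hd y hy').deriv]
        have := hb y hy'.1 (hcon y hy'.1).le
        linarith
    have h1 := hanti (left_mem_Icc.2 hTx) (right_mem_Icc.2 hTx) hTx
    have h2 := hcon x hTx
    have h3 : c * x = c * T + (u T - m) := by rw [hx]; field_simp
    simp only at h1
    linarith
  obtain ⟨t1, ht1, hu1⟩ := hex
  filter_upwards [eventually_ge_atTop t1] with t ht
  have := image_le_of_deriv_right_lt_deriv_boundary' (f := u) (f' := u') (a := t1) (b := t)
    (B := fun _ => m) (B' := fun _ => 0)
    (fun x hx => (h x (ht1.trans hx.1)).continuousAt.continuousWithinAt)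
    (fun x hx => (h x (ht1.trans hx.1)).hasDerivWithinAt) hu1 continuousOn_const
    (fun x _ => hasDerivWithinAt_const _ _ _)
    (fun x hx hxm => by
      have := hb x (ht1.trans hx.1) hxm.ge
      linarith)
  exact this (right_mem_Icc.2 ht)

lemma aux_min (x : ℝ) : HasDerivAt (fun y : ℝ => (min y 0) ^ 2) (2 * min x 0) x := by
  rcases lt_trichotomy x 0 with hx | hx | hx
  · rw [min_eq_left hx.le]
    have h1 : HasDerivAt (fun y : ℝ => y ^ 2) (2 * x) x := by simpa using hasDerivAt_pow 2 x
    apply h1.congr_of_eventuallyEq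
    filter_upwards [Iio_mem_nhds hx] with y hy
    rw [min_eq_left (le_of_lt hy)]
  · subst hx
    simp only [min_self, mul_zero]
    rw [hasDerivAt_iff_isLittleO]
    simp only [min_self, smul_zero, sub_zero]
    have h1 : HasDerivAt (fun y : ℝ => y ^ 2) 0 0 := by simpa using hasDerivAt_pow 2 (0:ℝ)
    rw [hasDerivAt_iff_isLittleO] at h1
    simp only [smul_zero, sub_zero] at h1
    refine Asymptotics.IsBigO.trans_isLittleO ?_ h1
    apply Asymptotics.IsBigO.of_bound 1
    filter_upwards with y
    rcases le_total y 0 with hy | hy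
    · simp [min_eq_left hy]
    · simp [min_eq_right hy, sq_nonneg]
  · rw [min_eq_right hx.le]
    have h1 : HasDerivAt (fun y : ℝ => (0:ℝ)) (2 * 0) x := by simpa using hasDerivAt_const x (0:ℝ)
    apply h1.congr_of_eventuallyEq
    filter_upwards [Ioi_mem_nhds hx] with y hy
    rw [min_eq_right (le_of_lt hy)]; simp

lemma aux_bdd (f : ℝ → ℝ) (a b : ℝ) (hf : ContinuousOn f (Icc a b)) :
    ∃ M, 0 ≤ M ∧ ∀ x ∈ Icc a b, |f x| ≤ M := by
  obtain ⟨M, hM⟩ := isCompact_Icc.exists_bound_of_continuousOn hf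
  exact ⟨max M 0, le_max_right _ _, fun x hx => (hM x hx).trans (le_max_left _ _)⟩

lemma aux_zero (x : ℝ) (h : (min x 0) ^ 2 ≤ 0) : 0 ≤ x := by
  by_contra hx
  push Not at hx
  rw [min_eq_left hx.le] at h
  nlinarith

lemma aux_nonneg_s12 (i g : ℝ → ℝ) (hi : ∀ t, 0 ≤ t → HasDerivAt i (g t * i t) t)
    (hg : ∀ t, 0 ≤ t → ContinuousAt g t) (h0 : 0 ≤ i 0) : ∀ t, 0 ≤ t → 0 ≤ i t := by
  intro t ht
  obtain ⟨M, hM0, hM⟩ := aux_bdd g 0 t (fun x hx => (hg x hx.1).continuousWithinAt)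
  have := aux_gron (fun t => (min (i t) 0) ^ 2) (fun t => 2 * min (i t) 0 * (g t * i t)) (2 * M) 0 t
    (fun x hx => (aux_min (i x)).comp x (hi x hx.1)) (fun x hx => by
      have h1 := (abs_le.1 (hM x hx)).2
      rcases le_total (i x) 0 with h | h
      · simp only [min_eq_left h]; nlinarith [sq_nonneg (i x)]
      · simp [min_eq_right h]) t ⟨ht, le_rfl⟩
  simp only [min_eq_right h0] at this
  exact aux_zero _ (by simpa using this)

/-- cooperative local invariance -/
lemma aux_coop (a i s : ℝ → ℝ) (k m f g P Q : ℝ → ℝ) (C t0 t1 : ℝ) (hC : 0 ≤ C)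
    (ha : ∀ t ∈ Icc t0 t1, HasDerivAt a (k t * a t + f t * s t + P t) t)
    (hs : ∀ t ∈ Icc t0 t1, HasDerivAt s (g t * a t + m t * s t + Q t) t)
    (hk : ∀ t ∈ Icc t0 t1, k t ≤ C) (hm : ∀ t ∈ Icc t0 t1, m t ≤ C)
    (hf0 : ∀ t ∈ Icc t0 t1, 0 ≤ f t) (hf : ∀ t ∈ Icc t0 t1, f t ≤ C)
    (hg0 : ∀ t ∈ Icc t0 t1, 0 ≤ g t) (hg : ∀ t ∈ Icc t0 t1, g t ≤ C)
    (hP : ∀ t ∈ Icc t0 t1, 0 ≤ P t) (hQ : ∀ t ∈ Icc t0 t1, 0 ≤ Q t)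
    (ha0 : 0 ≤ a t0) (hs0 : 0 ≤ s t0) : ∀ t ∈ Icc t0 t1, 0 ≤ a t ∧ 0 ≤ s t := by
  intro t ht
  have := aux_gron (fun t => (min (a t) 0) ^ 2 + (min (s t) 0) ^ 2)
    (fun t => 2 * min (a t) 0 * (k t * a t + f t * s t + P t) +
      2 * min (s t) 0 * (g t * a t + m t * s t + Q t)) (4 * C) t0 t1
    (fun x hx => ((aux_min (a x)).comp x (ha x hx)).add ((aux_min (s x)).comp x (hs x hx)))
    (fun x hx => by
      have h1 := hk x hx
      have h2 := hm x hx
      have h3 := hf0 x hx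
      have h4 := hf x hx
      have h5 := hg0 x hx
      have h6 := hg x hx
      have h7 := hP x hx
      have h8 := hQ x hx
      have key : ∀ u v kk ff pp : ℝ, kk ≤ C → 0 ≤ ff → ff ≤ C → 0 ≤ pp →
          2 * min u 0 * (kk * u + ff * v + pp) ≤ 2 * C * (min u 0) ^ 2 +
            C * ((min u 0) ^ 2 + (min v 0) ^ 2) := by
        intro u v kk ff pp e1 e2 e3 e4
        have w1 : min u 0 ≤ 0 := min_le_right _ _
        have w2 : min v 0 ≤ 0 := min_le_right _ _
        have w3 : min v 0 ≤ v := min_le_left _ _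
        have w4 : min u 0 * u = (min u 0) ^ 2 := by
          rcases le_total u 0 with h | h
          · rw [min_eq_left h]; ring
          · rw [min_eq_right h]; ring
        generalize min u 0 = U at *
        generalize min v 0 = V at *
        have q1 : kk * (U * u) ≤ C * U ^ 2 := by rw [w4]; nlinarith [sq_nonneg U]
        have q2 : ff * (U * v) ≤ ff * (U * V) :=
          mul_le_mul_of_nonneg_left (mul_le_mul_of_nonpos_left w3 w1) e2
        have q3 : ff * (U * V) ≤ C * (U * V) :=
          mul_le_mul_of_nonneg_right e3 (mul_nonneg_of_nonpos_of_nonpos w1 w2)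
        have q4 : C * (2 * (U * V)) ≤ C * (U ^ 2 + V ^ 2) :=
          mul_le_mul_of_nonneg_left (by nlinarith [sq_nonneg (U - V)]) hC
        have q5 : U * pp ≤ 0 := mul_nonpos_of_nonpos_of_nonneg w1 e4
        nlinarith
      have r1 := key (a x) (s x) _ _ _ h1 h3 h4 h7
      have r2 := key (s x) (a x) _ _ _ h2 h5 h6 h8
      have e : g x * a x + m x * s x + Q x = m x * s x + g x * a x + Q x := by ring
      simp only [e]
      nlinarith) t ht
  simp only [min_eq_right ha0, min_eq_right hs0] at this
  have h0 : min (a t) 0 ^ 2 + min (s t) 0 ^ 2 ≤ 0 := by simpa using this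
  exact ⟨aux_zero _ (by nlinarith [sq_nonneg (min (s t) 0)]),
    aux_zero _ (by nlinarith [sq_nonneg (min (a t) 0)])⟩

theorem sais_P2_global_stability
    (αi αa p δa : ℝ → ℝ) (β βa δ : ℝ)
    (hαi_diff : DifferentiableOn ℝ αi (Set.Icc 0 1))
    (hαa_diff : DifferentiableOn ℝ αa (Set.Icc 0 1))
    (hp_diff : DifferentiableOn ℝ p (Set.Icc 0 1))
    (hδa_diff : DifferentiableOn ℝ δa (Set.Icc 0 1))
    (hαi_nonneg : ∀ x ∈ Set.Icc (0:ℝ) 1, 0 ≤ αi x)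
    (hαa_nonneg : ∀ x ∈ Set.Icc (0:ℝ) 1, 0 ≤ αa x)
    (hp_nonneg : ∀ x ∈ Set.Icc (0:ℝ) 1, 0 ≤ p x)
    (hδa_nonneg : ∀ x ∈ Set.Icc (0:ℝ) 1, 0 ≤ δa x)
    (hp_le_one : ∀ x ∈ Set.Icc (0:ℝ) 1, p x ≤ 1)
    (hδa0_pos : 0 < δa 0)
    (hαa_pos : ∀ x ∈ Set.Ioc (0:ℝ) 1, 0 < αa x)
    (hαip_pos : ∀ x ∈ Set.Ioc (0:ℝ) 1, 0 < αi x + p x)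
    (hβa_nonneg : 0 ≤ βa) (hβaβ : βa < β) (hδ_pos : 0 < δ)
    (hR0 : β ≤ δ) (hR0a : δa 0 < αa 0) :
    (∀ a0 i0 : ℝ, 0 ≤ a0 → 0 ≤ i0 → a0 + i0 ≤ 1 →
      αi (i0) * (1 - a0 - i0) * (i0) + αa (i0) * (1 - a0 - i0) * (a0) + p (i0) * δ * (i0) - βa * (a0) * (i0) - δa (i0) * (a0) = 0 →
      (β * (1 - a0 - i0) + βa * (a0) - δ) * (i0) = 0 →
      (a0, i0) = ((0:ℝ), (0:ℝ)) ∨ (a0, i0) = (1 - δa 0 / αa 0, (0:ℝ))) ∧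
    (∀ a i : ℝ → ℝ,
      (∀ t : ℝ, 0 ≤ t → HasDerivAt a (αi (i t) * (1 - a t - i t) * (i t) + αa (i t) * (1 - a t - i t) * (a t) + p (i t) * δ * (i t) - βa * (a t) * (i t) - δa (i t) * (a t)) t) →
      (∀ t : ℝ, 0 ≤ t → HasDerivAt i ((β * (1 - a t - i t) + βa * (a t) - δ) * (i t)) t) →
      0 ≤ a 0 → 0 ≤ i 0 → a 0 + i 0 ≤ 1 → (a 0, i 0) ≠ ((0:ℝ), (0:ℝ)) →
      Filter.Tendsto (fun t => (a t, i t)) Filter.atTop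
        (nhds (1 - δa 0 / αa 0, (0:ℝ)))) := by
  have hβ : 0 < β := lt_of_le_of_lt hβa_nonneg hβaβ
  have hα0 : 0 < αa 0 := hδa0_pos.trans hR0a
  constructor
  · intro a0 i0 ha hi hai h1 h2
    rcases mul_eq_zero.1 h2 with h | h
    · have hi0 : i0 = 0 := by
        by_contra hne
        have : 0 < i0 := lt_of_le_of_ne hi (Ne.symm hne)
        nlinarith [mul_pos hβ this, mul_nonneg (sub_nonneg.2 hβaβ.le) ha]
      subst hi0
      have : a0 = 0 := by nlinarith
      left; simp [this]
    · subst h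
      have h3 : a0 * (αa 0 * (1 - a0) - δa 0) = 0 := by linear_combination h1
      rcases mul_eq_zero.1 h3 with h | h
      · left; simp [h]
      · right
        have : a0 = 1 - δa 0 / αa 0 := by field_simp; linarith
        rw [this]
  intro a i ha hi ha0 hi0 hai0 hne
  have hac : ∀ t, 0 ≤ t → ContinuousAt a t := fun t ht => (ha t ht).continuousAt
  have hic : ∀ t, 0 ≤ t → ContinuousAt i t := fun t ht => (hi t ht).continuousAt
  have hipos : ∀ t, 0 ≤ t → 0 ≤ i t := by
    refine aux_nonneg_s12 i (fun t => β * (1 - a t - i t) + βa * a t - δ) hi ?_ hi0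
    intro t ht
    have := hac t ht
    have := hic t ht
    fun_prop
  obtain ⟨M1, hM10, hM1⟩ := aux_bdd αi 0 1 hαi_diff.continuousOn
  obtain ⟨M2, hM20, hM2⟩ := aux_bdd αa 0 1 hαa_diff.continuousOn
  obtain ⟨M3, hM30, hM3⟩ := aux_bdd δa 0 1 hδa_diff.continuousOn
  -- invariance
  have hΩ : ∀ t, 0 ≤ t → 0 ≤ a t ∧ 0 ≤ 1 - a t - i t := by
    intro b hb
    have hcl : IsClosed ({t | 0 ≤ a t ∧ 0 ≤ 1 - a t - i t} ∩ Icc 0 b) := by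
      have c1 : ContinuousOn a (Icc 0 b) := fun x hx => (hac x hx.1).continuousWithinAt
      have c2 : ContinuousOn i (Icc 0 b) := fun x hx => (hic x hx.1).continuousWithinAt
      have c3 : ContinuousOn (fun t => (a t, 1 - a t - i t)) (Icc 0 b) := by fun_prop
      have := c3.preimage_isClosed_of_isClosed isClosed_Icc
        ((isClosed_Ici (a := (0:ℝ))).prod (isClosed_Ici (a := (0:ℝ))))
      rw [inter_comm]
      exact this
    refine hcl.Icc_subset_of_forall_mem_nhdsWithin ⟨ha0, by linarith⟩ ?_ ⟨hb, le_rfl⟩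
    rintro t ⟨⟨hat, hst⟩, ht⟩
    have hev : ∀ᶠ x in nhdsWithin t (Ioi t), i x ≤ 1 := by
      rcases lt_or_eq_of_le (show i t ≤ 1 by linarith) with h | h
      · have := (hic t ht.1).eventually (gt_mem_nhds h)
        exact (this.filter_mono nhdsWithin_le_nhds).mono fun x hx => hx.le
      · have hd := hi t ht.1
        have hat0 : a t = 0 := by linarith
        have hneg : (β * (1 - a t - i t) + βa * a t - δ) * i t < 0 := by
          rw [hat0, h]; linarith
        have := (hasDerivAt_iff_tendsto_slope.1 hd).eventually (gt_mem_nhds hneg)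
        have h2 := this.filter_mono (nhdsWithin_mono t
          (fun x (hx : t < x) => (ne_of_gt hx : x ≠ t)))
        filter_upwards [h2, self_mem_nhdsWithin] with x hx hxt
        rw [slope_def_field, div_lt_iff₀ (sub_pos.2 hxt)] at hx
        linarith
    obtain ⟨t1, ht1, hsub⟩ := (mem_nhdsGT_iff_exists_Ioc_subset).1 hev
    have hle : ∀ x ∈ Icc t t1, i x ≤ 1 := by
      intro x hx
      rcases eq_or_lt_of_le hx.1 with h | h
      · rw [← h]; linarith
      · exact hsub ⟨h, hx.2⟩
    have h0x : ∀ x ∈ Icc t t1, 0 ≤ x := fun x hx => ht.1.trans hx.1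
    have hI : ∀ x ∈ Icc t t1, i x ∈ Icc (0:ℝ) 1 := fun x hx => ⟨hipos x (h0x x hx), hle x hx⟩
    obtain ⟨N, hN0, hN⟩ := aux_bdd a t t1 (fun x hx => (hac x (h0x x hx)).continuousWithinAt)
    have hcoop := aux_coop a i (fun t => 1 - a t - i t)
      (fun t => αa (i t) * (1 - a t - i t) - βa * i t - δa (i t))
      (fun t => -(αi (i t) * i t + αa (i t) * a t + β * i t))
      (fun t => αi (i t) * i t) (fun t => δa (i t))
      (fun t => p (i t) * δ * i t) (fun t => (1 - p (i t)) * δ * i t)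
      (M1 + M2 * (1 + N) + M3) t t1 (by positivity)
      (fun x hx => by
        refine (ha x (h0x x hx)).congr_deriv ?_
        ring)
      (fun x hx => by
        refine (((ha x (h0x x hx)).const_sub 1).sub (hi x (h0x x hx))).congr_deriv ?_
        ring)
      (fun x hx => by
        have hix := hI x hx
        have q1 := hαa_nonneg _ hix
        have q2 := (abs_le.1 (hM2 _ hix)).2
        have q3 := hδa_nonneg _ hix
        have q4 := (abs_le.1 (hN x hx)).1
        have q5 := mul_nonneg hβa_nonneg hix.1
        have q6 : αa (i x) * (1 - a x - i x) ≤ αa (i x) * (1 + N) :=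
          mul_le_mul_of_nonneg_left (by linarith [hix.1]) q1
        have q7 : αa (i x) * (1 + N) ≤ M2 * (1 + N) :=
          mul_le_mul_of_nonneg_right q2 (by linarith)
        linarith)
      (fun x hx => by
        have hix := hI x hx
        have q1 := hαa_nonneg _ hix
        have q2 := (abs_le.1 (hM2 _ hix)).2
        have q4 := (abs_le.1 (hN x hx)).1
        have q5 := mul_nonneg hβ.le hix.1
        have q8 := mul_nonneg (hαi_nonneg _ hix) hix.1
        have q6 : αa (i x) * (-a x) ≤ αa (i x) * (1 + N) :=
          mul_le_mul_of_nonneg_left (by linarith [hix.1]) q1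
        have q7 : αa (i x) * (1 + N) ≤ M2 * (1 + N) :=
          mul_le_mul_of_nonneg_right q2 (by linarith)
        linarith)
      (fun x hx => mul_nonneg (hαi_nonneg _ (hI x hx)) (hI x hx).1)
      (fun x hx => by
        have hix := hI x hx
        have q1 := hαi_nonneg _ hix
        have q2 := (abs_le.1 (hM1 _ hix)).2
        have q3 : αi (i x) * i x ≤ αi (i x) * 1 := mul_le_mul_of_nonneg_left hix.2 q1
        have q4 : 0 ≤ M2 * (1 + N) := by positivity
        linarith)
      (fun x hx => hδa_nonneg _ (hI x hx))
      (fun x hx => by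
        have q2 := (abs_le.1 (hM3 _ (hI x hx))).2
        have q4 : 0 ≤ M2 * (1 + N) := by positivity
        linarith)
      (fun x hx => mul_nonneg (mul_nonneg (hp_nonneg _ (hI x hx)) hδ_pos.le) (hI x hx).1)
      (fun x hx => mul_nonneg (mul_nonneg (sub_nonneg.2 (hp_le_one _ (hI x hx))) hδ_pos.le)
        (hI x hx).1)
      hat hst
    exact mem_of_superset (Ioc_mem_nhdsGT ht1) fun x hx => hcoop x ⟨hx.1.le, hx.2⟩
  have hI : ∀ t, 0 ≤ t → i t ∈ Icc (0:ℝ) 1 := fun t ht =>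
    ⟨hipos t ht, by linarith [(hΩ t ht).1, (hΩ t ht).2]⟩
  -- i tends to 0
  have hilim : Tendsto i atTop (nhds 0) := by
    rw [Metric.tendsto_nhds]
    intro ε hε
    have := aux_event i _ 0 (β * (ε / 2) ^ 2) (ε / 2) (by positivity) hi (by
      intro t ht hm
      have h1 := (hΩ t ht).1
      have h2 := hipos t ht
      have h3 : β * (1 - a t - i t) + βa * a t - δ ≤ - (β * i t) := by nlinarith
      have h4 := mul_le_mul_of_nonneg_right h3 h2
      have h5 : (ε / 2) ^ 2 ≤ i t ^ 2 := by gcongr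
      nlinarith)
    filter_upwards [this, eventually_ge_atTop 0] with t h1 h2
    rw [Real.dist_eq, sub_zero, abs_of_nonneg (hipos t h2)]
    linarith
  -- a positive at some time
  have hex : ∃ t0, 0 ≤ t0 ∧ 0 < a t0 := by
    by_contra hcon
    push Not at hcon
    have haz : ∀ t, 0 ≤ t → a t = 0 := fun t ht => le_antisymm (hcon t ht) (hΩ t ht).1
    have hi0' : 0 < i 0 := by
      refine lt_of_le_of_ne hi0 fun h => hne ?_
      rw [haz 0 le_rfl, ← h]
    obtain ⟨T, hT1, hT2⟩ := ((hilim.eventually (gt_mem_nhds (half_pos hi0'))).and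
      (eventually_gt_atTop 0)).exists
    obtain ⟨t, ht, hit⟩ := intermediate_value_Ioo' hT2.le
      (fun x hx => (hic x hx.1).continuousWithinAt : ContinuousOn i (Icc 0 T))
      (show i 0 / 2 ∈ Ioo (i T) (i 0) from ⟨hT1, by linarith⟩)
    have ht0 : 0 ≤ t := ht.1.le
    have hd := ha t ht0
    have hd0 : HasDerivAt a 0 t := by
      refine (hasDerivAt_const t (0:ℝ)).congr_of_eventuallyEq ?_
      filter_upwards [Ioi_mem_nhds ht.1] with x hx
      exact haz x (le_of_lt hx)
    have he := hd.unique hd0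
    rw [haz t ht0] at he
    have hitp : 0 < i t := by rw [hit]; linarith
    have hix := hI t ht0
    have hs : 0 < 1 - i t := by rw [hit]; linarith [(hI 0 le_rfl).2]
    have e1 := hαi_nonneg _ hix
    have e2 := hp_nonneg _ hix
    have e3 := hαip_pos _ ⟨hitp, hix.2⟩
    have f1 : 0 ≤ αi (i t) * ((1 - i t) * i t) := by positivity
    have f2 : 0 ≤ p (i t) * (δ * i t) := by positivity
    have g1 : αi (i t) * ((1 - i t) * i t) = 0 := by nlinarith
    have g2 : p (i t) * (δ * i t) = 0 := by nlinarith
    have g3 : αi (i t) = 0 := (mul_eq_zero.1 g1).resolve_right (by positivity)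
    have g4 : p (i t) = 0 := (mul_eq_zero.1 g2).resolve_right (by positivity)
    linarith
  obtain ⟨t0, ht0, hat0⟩ := hex
  have hapos : ∀ t, t0 ≤ t → 0 < a t := by
    intro t ht
    have := aux_gron (fun t => -a t) _ (-(βa + M3)) t0 t
      (fun x hx => (ha x (ht0.trans hx.1)).neg) (fun x hx => by
        have hx0 := ht0.trans hx.1
        have hix := hI x hx0
        have w := hΩ x hx0
        have q1 := mul_nonneg (mul_nonneg (hαi_nonneg _ hix) w.2) hix.1
        have q2 := mul_nonneg (mul_nonneg (hαa_nonneg _ hix) w.2) w.1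
        have q3 := mul_nonneg (mul_nonneg (hp_nonneg _ hix) hδ_pos.le) hix.1
        have q4 : βa * a x * i x ≤ βa * a x * 1 :=
          mul_le_mul_of_nonneg_left hix.2 (mul_nonneg hβa_nonneg w.1)
        have q5 : δa (i x) * a x ≤ M3 * a x :=
          mul_le_mul_of_nonneg_right (abs_le.1 (hM3 _ hix)).2 w.1
        linarith) t ⟨ht, le_rfl⟩
    have he := Real.exp_pos (-(βa + M3) * (t - t0))
    have := mul_pos hat0 he
    linarith
  -- limits of coefficients
  have hiw : Tendsto i atTop (nhdsWithin 0 (Icc 0 1)) := by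
    rw [tendsto_nhdsWithin_iff]
    refine ⟨hilim, ?_⟩
    filter_upwards [eventually_ge_atTop 0] with t ht using hI t ht
  have h01 : (0:ℝ) ∈ Icc (0:ℝ) 1 := ⟨le_rfl, zero_le_one⟩
  have hla : Tendsto (fun t => αa (i t)) atTop (nhds (αa 0)) :=
    (hαa_diff.continuousOn 0 h01).tendsto.comp hiw
  have hld : Tendsto (fun t => δa (i t)) atTop (nhds (δa 0)) :=
    (hδa_diff.continuousOn 0 h01).tendsto.comp hiw
  set A := 1 - δa 0 / αa 0 with hA
  have hAeq : αa 0 * A = αa 0 - δa 0 := by rw [hA]; field_simp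
  have hApos : 0 < A := by
    rw [hA, sub_pos, div_lt_one hα0]; exact hR0a
  -- error bounds
  have herr : ∀ η > 0, ∀ᶠ t in atTop, |(αa (i t) * (1 - a t - i t) - βa * i t - δa (i t)) -
      αa 0 * (A - a t)| ≤ η := by
    intro η hη
    have l1 : Tendsto (fun t => |αa (i t) - αa 0| + (αa 0 + βa) * i t + |δa (i t) - δa 0|) atTop
        (nhds (|αa 0 - αa 0| + (αa 0 + βa) * 0 + |δa 0 - δa 0|)) :=
      (((hla.sub_const _).abs).add (hilim.const_mul _)).add ((hld.sub_const _).abs)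
    simp only [sub_self, abs_zero, mul_zero, add_zero] at l1
    filter_upwards [l1.eventually (gt_mem_nhds hη), eventually_ge_atTop 0] with t h1 h2
    have w := hΩ t h2
    have w2 := hipos t h2
    have e : (αa (i t) * (1 - a t - i t) - βa * i t - δa (i t)) - αa 0 * (A - a t) =
      (αa (i t) - αa 0) * (1 - a t - i t) - (αa 0 + βa) * i t - (δa (i t) - δa 0) := by
      linear_combination -hAeq
    rw [e]
    have b1 : |(αa (i t) - αa 0) * (1 - a t - i t)| ≤ |αa (i t) - αa 0| := by
      rw [abs_mul, abs_of_nonneg w.2]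
      exact mul_le_of_le_one_right (abs_nonneg _) (by linarith [w.1])
    have b2 := abs_le.1 b1
    have b3 := abs_le.1 (le_refl |δa (i t) - δa 0|)
    have b4 : 0 ≤ (αa 0 + βa) * i t := by positivity
    rw [abs_le]
    constructor <;> linarith [b2.1, b2.2, b3.1, b3.2]
  have halim : Tendsto a atTop (nhds A) := by
    rw [tendsto_order]
    constructor
    · intro x hx
      set m := (max x 0 + A) / 2 with hm
      have hmA : max x 0 < A := max_lt hx hApos
      have hm0 : 0 < m := by have := le_max_right x 0; linarith
      have hmx : x < m := by have := le_max_left x 0; linarith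
      have hη : 0 < αa 0 * (A - m) / 2 := by
        have : 0 < A - m := by linarith
        positivity
      obtain ⟨T, hT⟩ := eventually_atTop.1 (herr _ hη)
      have := aux_event (fun t => -Real.log (a t)) _ (max T t0) (αa 0 * (A - m) / 2)
        (-Real.log m) hη
        (fun t ht => ((ha t (ht0.trans (le_of_max_le_right ht))).log
          (hapos t (le_of_max_le_right ht)).ne').neg) (by
          intro t ht hle
          have htt := le_of_max_le_right ht
          have hp0 := hapos t htt
          have hx0 := ht0.trans htt
          have hix := hI t hx0
          have w := hΩ t hx0
          have hle' : a t ≤ m := (Real.log_le_log_iff hp0 hm0).1 (by linarith)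
          have hb := (abs_le.1 (hT t (le_of_max_le_left ht))).1
          have hmono : αa 0 * (A - m) ≤ αa 0 * (A - a t) :=
            mul_le_mul_of_nonneg_left (by linarith) hα0.le
          have q1 := mul_nonneg (mul_nonneg (hαi_nonneg _ hix) w.2) hix.1
          have q3 := mul_nonneg (mul_nonneg (hp_nonneg _ hix) hδ_pos.le) hix.1
          rw [neg_le_neg_iff, le_div_iff₀ hp0]
          have := mul_le_mul_of_nonneg_right (show αa 0 * (A - m) / 2 ≤
            αa (i t) * (1 - a t - i t) - βa * i t - δa (i t) by linarith) hp0.le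
          linarith)
      filter_upwards [this, eventually_ge_atTop t0] with t h1 h2
      have := (Real.log_le_log_iff hm0 (hapos t h2)).1 (by linarith)
      linarith
    · intro x hx
      set m := (x + A) / 2 with hm
      have hmA : A < m := by linarith
      have hη : 0 < αa 0 * (m - A) / 2 := by
        have : 0 < m - A := by linarith
        positivity
      have hc : 0 < A * (αa 0 * (m - A) / 2) / 2 := by positivity
      have hf : Tendsto (fun t => (M1 + δ) * i t) atTop (nhds ((M1 + δ) * 0)) := hilim.const_mul _
      rw [mul_zero] at hf
      obtain ⟨T, hT⟩ := eventually_atTop.1 ((herr _ hη).and (hf.eventually (gt_mem_nhds hc)))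
      have := aux_event a _ (max T 0) (A * (αa 0 * (m - A) / 2) / 2) m hc
        (fun t ht => ha t (le_of_max_le_right ht)) (by
          intro t ht hle
          have hx0 := le_of_max_le_right ht
          have hix := hI t hx0
          have w := hΩ t hx0
          obtain ⟨hb1, hb2⟩ := hT t (le_of_max_le_left ht)
          have hb := (abs_le.1 hb1).2
          have hmono : αa 0 * (m - A) ≤ αa 0 * (a t - A) :=
            mul_le_mul_of_nonneg_left (by linarith) hα0.le
          have q1 : αi (i t) * (1 - a t - i t) ≤ M1 * 1 :=
            mul_le_mul (abs_le.1 (hM1 _ hix)).2 (by linarith [w.1, hix.1]) w.2 hM10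
          have q2 := mul_le_mul_of_nonneg_right q1 hix.1
          have q3 : p (i t) * (δ * i t) ≤ 1 * (δ * i t) :=
            mul_le_mul_of_nonneg_right (hp_le_one _ hix) (mul_nonneg hδ_pos.le hix.1)
          have q4 := mul_le_mul_of_nonneg_right (show
            αa (i t) * (1 - a t - i t) - βa * i t - δa (i t) ≤ -(αa 0 * (m - A) / 2) by
              linarith) w.1
          have q5 : A * (αa 0 * (m - A) / 2) ≤ a t * (αa 0 * (m - A) / 2) :=
            mul_le_mul_of_nonneg_right (by linarith) hη.le
          linarith)
      filter_upwards [this] with t h1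
      linarith
  exact halim.prodMk_nhds hilim
end

section
/- Consider the reactive SAIS model with constant rate coefficients α_i(i) = α_i, α_a(i) = α_a, p(i) = p, δ_a(i) = δ_a, and suppose β > δ, α_a > δ_a, β − δ − (β − β_a)(1 − δ_a/α_a) < 0, and (α_a − δ_a)/(α_a + β_a) ≥ 1 − δ/β. Then the disease-free equilibrium P₂ = (1 − δ_a/α_a, 0) is globally asymptotically stable on Ω ∖ {(0,0)}: every differentiable solution (a(t), i(t)) of the system defined for t ≥ 0 with (a(0), i(0)) ∈ Ω and (a(0), i(0)) ≠ (0,0) converges to P₂ as t → ∞. -/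
open Set Filter

lemma sais_mono (f f' : ℝ → ℝ) (T S : ℝ)
    (h : ∀ t, T ≤ t → t ≤ S → HasDerivAt f (f' t) t)
    (h0 : ∀ t, T ≤ t → t ≤ S → 0 ≤ f' t) (hTS : T ≤ S) : f T ≤ f S := by
  have : MonotoneOn f (Icc T S) := by
    apply monotoneOn_of_deriv_nonneg (convex_Icc T S)
    · intro t ht
      exact (h t ht.1 ht.2).continuousAt.continuousWithinAt
    · intro t ht
      rw [interior_Icc] at ht
      exact (h t ht.1.le ht.2.le).differentiableAt.differentiableWithinAt
    · intro t ht
      rw [interior_Icc] at ht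
      rw [(h t ht.1.le ht.2.le).deriv]
      exact h0 t ht.1.le ht.2.le
  exact this ⟨le_refl _, hTS⟩ ⟨hTS, le_refl _⟩ hTS

lemma sais_neg (x : ℝ) : HasDerivAt (fun x : ℝ => (min x 0)^2) (2 * min x 0) x := by
  rcases lt_trichotomy x 0 with h | h | h
  · have : HasDerivAt (fun x : ℝ => x^2) (2 * x) x := by
      simpa using hasDerivAt_pow 2 x
    rw [min_eq_left h.le]
    refine this.congr_of_eventuallyEq ?_
    filter_upwards [gt_mem_nhds h] with y hy
    rw [min_eq_left (le_of_lt hy)]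
  · subst h
    rw [hasDerivAt_iff_isLittleO]
    simp only [min_self, mul_zero, sub_zero, smul_zero]
    have h2 : (fun x : ℝ => (min x 0)^2 - 0^2) =O[nhds 0] (fun x : ℝ => x^2) := by
      apply Asymptotics.IsBigO.of_bound 1
      filter_upwards with y
      have : |min y 0| ≤ |y| := by
        rcases le_total y 0 with hy | hy
        · rw [min_eq_left hy]
        · rw [min_eq_right hy]; simp
      simp only [Real.norm_eq_abs, abs_pow, one_mul]
      have e : (min y 0)^2 - 0^2 = (min y 0)^2 := by ring
      rw [e, abs_pow]
      gcongr
    have h3 : (fun x : ℝ => x^2) =o[nhds 0] (fun x : ℝ => x) := by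
      simpa using Asymptotics.isLittleO_pow_id (𝕜 := ℝ) (one_lt_two)
    exact h2.trans_isLittleO h3
  · rw [min_eq_right h.le, mul_zero]
    refine (hasDerivAt_const x (0:ℝ)).congr_of_eventuallyEq ?_
    filter_upwards [lt_mem_nhds h] with y hy
    rw [min_eq_right (le_of_lt hy)]; norm_num

lemma sais_coop (x y g b u c d v : ℝ → ℝ) (T : ℝ) (hT : 0 ≤ T)
    (hx : ∀ t, 0 ≤ t → t ≤ T → HasDerivAt x (g t * x t + b t * y t + u t) t)
    (hy : ∀ t, 0 ≤ t → t ≤ T → HasDerivAt y (c t * x t + d t * y t + v t) t)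
    (hg : ContinuousOn g (Icc 0 T)) (hb : ContinuousOn b (Icc 0 T))
    (hc : ContinuousOn c (Icc 0 T)) (hd : ContinuousOn d (Icc 0 T))
    (hb0 : ∀ t, 0 ≤ t → t ≤ T → 0 ≤ b t) (hc0 : ∀ t, 0 ≤ t → t ≤ T → 0 ≤ c t)
    (hu0 : ∀ t, 0 ≤ t → t ≤ T → 0 ≤ u t) (hv0 : ∀ t, 0 ≤ t → t ≤ T → 0 ≤ v t)
    (hx0 : 0 ≤ x 0) (hy0 : 0 ≤ y 0) : 0 ≤ x T ∧ 0 ≤ y T := by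
  obtain ⟨K1, h1⟩ := isCompact_Icc.exists_bound_of_continuousOn hg
  obtain ⟨K2, h2⟩ := isCompact_Icc.exists_bound_of_continuousOn hb
  obtain ⟨K3, h3⟩ := isCompact_Icc.exists_bound_of_continuousOn hc
  obtain ⟨K4, h4⟩ := isCompact_Icc.exists_bound_of_continuousOn hd
  obtain ⟨K, e1, e2, e3, e4⟩ : ∃ K, K1 ≤ K ∧ K2 ≤ K ∧ K3 ≤ K ∧ K4 ≤ K :=
    ⟨max (max K1 K2) (max K3 K4), by simp, by simp, by simp, by simp⟩
  have hE : ∀ t : ℝ, HasDerivAt (fun t => Real.exp (-(4*K)*t)) (Real.exp (-(4*K)*t) * (-(4*K))) t := by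
    intro t
    have := ((hasDerivAt_id t).const_mul (-(4*K))).exp
    simpa using this
  have key := sais_mono
    (fun t => -(((min (x t) 0)^2 + (min (y t) 0)^2) * Real.exp (-(4*K)*t))) _ 0 T
    (fun t ht ht' => ((((sais_neg (x t)).comp t (hx t ht ht')).add
      ((sais_neg (y t)).comp t (hy t ht ht'))).mul (hE t)).neg) ?_ hT
  · simp only [min_eq_right hx0, min_eq_right hy0] at key
    have hp : 0 < Real.exp (-(4*K)*T) := Real.exp_pos _
    have hw : (min (x T) 0)^2 + (min (y T) 0)^2 ≤ 0 := by
      by_contra hcon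
      push Not at hcon
      have := mul_pos hcon hp
      linarith
    have k1 : min (x T) 0 = 0 := by
      have : (min (x T) 0)^2 = 0 := by nlinarith [sq_nonneg (min (x T) 0), sq_nonneg (min (y T) 0)]
      simpa using this
    have k2 : min (y T) 0 = 0 := by
      have : (min (y T) 0)^2 = 0 := by nlinarith [sq_nonneg (min (x T) 0), sq_nonneg (min (y T) 0)]
      simpa using this
    exact ⟨min_eq_right_iff.mp k1, min_eq_right_iff.mp k2⟩
  · intro t ht ht'
    have f1 := (le_abs_self _).trans ((h1 t ⟨ht, ht'⟩).trans e1)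
    have f2 := (le_abs_self _).trans ((h2 t ⟨ht, ht'⟩).trans e2)
    have f3 := (le_abs_self _).trans ((h3 t ⟨ht, ht'⟩).trans e3)
    have f4 := (le_abs_self _).trans ((h4 t ⟨ht, ht'⟩).trans e4)
    have hb0 := hb0 t ht ht'
    have hc0 := hc0 t ht ht'
    have hu0 := hu0 t ht ht'
    have hv0 := hv0 t ht ht'
    have hp : 0 < Real.exp (-(4*K)*t) := Real.exp_pos _
    have hK : 0 ≤ K := le_trans hb0 f2
    simp only [Function.comp_apply, Pi.add_apply]
    generalize Real.exp (-(4*K)*t) = E at *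
    generalize x t = X at *
    generalize y t = Y at *
    generalize g t = G at *
    generalize b t = B at *
    generalize c t = C at *
    generalize d t = D at *
    generalize u t = U at *
    generalize v t = V at *
    have main : ∀ X Y G B U : ℝ, G ≤ K → B ≤ K → 0 ≤ B → 0 ≤ U →
        2 * min X 0 * (G * X + B * Y + U) ≤ 2*K*(min X 0)^2 + 2 * K * (min X 0 * min Y 0) := by
      intro X Y G B U hG hB hB0 hU
      have hX : min X 0 ≤ 0 := min_le_right _ _
      have hY : min Y 0 ≤ 0 := min_le_right _ _
      have hYY : min Y 0 ≤ Y := min_le_left _ _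
      have hXX : min X 0 * X = (min X 0)^2 := by
        rcases le_total X 0 with hy | hy
        · rw [min_eq_left hy]; ring
        · rw [min_eq_right hy]; ring
      have a1 : min X 0 * (B * Y) ≤ K * (min X 0 * min Y 0) := by
        have : min X 0 * (B * Y) ≤ min X 0 * (B * min Y 0) :=
          mul_le_mul_of_nonpos_left (mul_le_mul_of_nonneg_left hYY hB0) hX
        nlinarith [mul_nonneg_of_nonpos_of_nonpos hX hY]
      have a2 : min X 0 * (G * X) ≤ K * (min X 0)^2 := by
        have : min X 0 * (G * X) = G * (min X 0)^2 := by rw [← hXX]; ring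
        rw [this]
        exact mul_le_mul_of_nonneg_right hG (sq_nonneg _)
      have a3 : min X 0 * U ≤ 0 := mul_nonpos_of_nonpos_of_nonneg hX hU
      nlinarith
    have m1 := main X Y G B U f1 f2 hb0 hu0
    have m2 := main Y X D C V f4 f3 hc0 hv0
    have m3 : 4 * K * (min X 0 * min Y 0) ≤ 2 * K * ((min X 0)^2 + (min Y 0)^2) := by
      nlinarith [mul_nonneg hK (sq_nonneg (min X 0 - min Y 0))]
    have m4 : 2 * min X 0 * (G * X + B * Y + U) + 2 * min Y 0 * (C * X + D * Y + V)
        - 4 * K * ((min X 0)^2 + (min Y 0)^2) ≤ 0 := by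
      have e : C * X + D * Y + V = D * Y + C * X + V := by ring
      rw [e]
      nlinarith
    nlinarith [mul_nonneg hp.le (neg_nonneg.mpr m4)]

lemma sais_decay (V V' h : ℝ → ℝ) (k T : ℝ) (hk : 0 < k)
    (hV : ∀ t, T ≤ t → HasDerivAt V (V' t) t)
    (hle : ∀ t, T ≤ t → V' t ≤ - k * V t + h t)
    (hh : Tendsto h atTop (nhds 0)) (hV0 : ∀ t, T ≤ t → 0 ≤ V t) :
    Tendsto V atTop (nhds 0) := by
  rw [Metric.tendsto_atTop]
  intro e he
  have h1 : ∀ᶠ t in atTop, h t < k * (e/2) := hh.eventually_lt_const (by positivity)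
  obtain ⟨S0, hS0⟩ := eventually_atTop.mp h1
  set S := max S0 T with hS
  have hST : T ≤ S := le_max_right _ _
  have hSS : S0 ≤ S := le_max_left _ _
  have hE : ∀ t : ℝ, HasDerivAt (fun t => Real.exp (k*t)) (Real.exp (k*t) * k) t := by
    intro t
    have := ((hasDerivAt_id t).const_mul k).exp
    simpa using this
  have key : ∀ t, S ≤ t → (V t - e/2) * Real.exp (k*t) ≤ (V S - e/2) * Real.exp (k*S) := by
    intro t ht
    have := sais_mono (fun t => -((V t - e/2) * Real.exp (k*t))) _ S t
      (fun r hr _ => (((hV r (hST.trans hr)).sub_const (e/2)).mul (hE r)).neg) ?_ ht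
    · simpa using this
    · intro r hr _
      have a1 := hle r (hST.trans hr)
      have a2 := hS0 r (hSS.trans hr)
      have hp : 0 < Real.exp (k*r) := Real.exp_pos _
      have : V' r + k * (V r - e/2) ≤ 0 := by nlinarith
      nlinarith [mul_nonneg hp.le (neg_nonneg.mpr this)]
  have hlim : Tendsto (fun t => |(V S - e/2) * Real.exp (k*S)| * Real.exp (-(k*t))) atTop (nhds 0) := by
    have : Tendsto (fun t => Real.exp (-(k*t))) atTop (nhds 0) :=
      Real.tendsto_exp_neg_atTop_nhds_zero.comp (tendsto_id.const_mul_atTop hk)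
    simpa using this.const_mul (|(V S - e/2) * Real.exp (k*S)|)
  obtain ⟨R, hR⟩ := eventually_atTop.mp (hlim.eventually_lt_const (show 0 < e/2 by positivity))
  refine ⟨max R S, fun t ht => ?_⟩
  have t1 : R ≤ t := (le_max_left _ _).trans ht
  have t2 : S ≤ t := (le_max_right _ _).trans ht
  have b1 := hR t t1
  have b2 := key t t2
  have b3 := hV0 t (hST.trans t2)
  rw [Real.dist_eq, sub_zero, abs_of_nonneg b3]
  have hp : 0 < Real.exp (-(k*t)) := Real.exp_pos _
  have hpe : Real.exp (k*t) * Real.exp (-(k*t)) = 1 := by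
    rw [← Real.exp_add]; simp
  have b4 := mul_le_mul_of_nonneg_right (b2.trans (le_abs_self _)) hp.le
  rw [mul_assoc, hpe] at b4
  linarith

set_option maxHeartbeats 2000000 in
theorem sais_const_P2_global_stability
    (αi αa p δa β βa δ : ℝ)
    (hαi_nonneg : 0 ≤ αi) (hαa_pos : 0 < αa)
    (hp_nonneg : 0 ≤ p) (hp_le_one : p ≤ 1)
    (hαip_pos : 0 < αi + p)
    (hδa_pos : 0 < δa) (hδ_pos : 0 < δ)
    (hβa_nonneg : 0 ≤ βa) (hβaβ : βa < β)
    (hR0 : δ < β) (hR0a : δa < αa)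
    (hlam2 : β - δ - (β - βa) * (1 - δa / αa) < 0)
    (hb1 : (αa - δa) / (αa + βa) ≥ 1 - δ / β) :
    ∀ a i : ℝ → ℝ,
      (∀ t : ℝ, 0 ≤ t → HasDerivAt a (αi * (1 - a t - i t) * (i t) + αa * (1 - a t - i t) * (a t) + p * δ * (i t) - βa * (a t) * (i t) - δa * (a t)) t) →
      (∀ t : ℝ, 0 ≤ t → HasDerivAt i ((β * (1 - a t - i t) + βa * (a t) - δ) * (i t)) t) →
      0 ≤ a 0 → 0 ≤ i 0 → a 0 + i 0 ≤ 1 → (a 0, i 0) ≠ ((0:ℝ), (0:ℝ)) →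
      Filter.Tendsto (fun t => (a t, i t)) Filter.atTop
        (nhds (1 - δa / αa, (0:ℝ))) := by
  intro a i ha hi ha0 hi0 hai0 hne
  have hβ : 0 < β := hδ_pos.trans hR0
  have hca : ∀ T, ContinuousOn a (Icc 0 T) := fun T t ht =>
    (ha t ht.1).continuousAt.continuousWithinAt
  have hci : ∀ T, ContinuousOn i (Icc 0 T) := fun T t ht =>
    (hi t ht.1).continuousAt.continuousWithinAt
  -- invariance
  have ipos : ∀ t, 0 ≤ t → 0 ≤ i t := by
    intro T hT
    refine (sais_coop i (fun _ => 0) (fun t => β * (1 - a t - i t) + βa * (a t) - δ)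
      (fun _ => 0) (fun _ => 0) (fun _ => 0) (fun _ => 0) (fun _ => 0) T hT ?_ ?_ ?_ ?_ ?_ ?_ ?_ ?_ ?_ ?_
      hi0 le_rfl).1
    · intro t ht _
      simpa using hi t ht
    · intro t _ _
      simpa using hasDerivAt_const t (0:ℝ)
    · have := hca T
      have := hci T
      fun_prop
    all_goals first | exact continuousOn_const | (intros; exact le_rfl)
  have aspos : ∀ t, 0 ≤ t → 0 ≤ a t ∧ 0 ≤ 1 - a t - i t := by
    intro T hT
    have hcaT := hca T
    have hciT := hci T
    refine sais_coop a (fun t => 1 - a t - i t)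
      (fun t => αa * (1 - a t - i t) - βa * i t - δa)
      (fun t => αi * i t) (fun t => p * δ * i t) (fun _ => δa)
      (fun t => -(αi * i t + αa * a t + β * i t)) (fun t => (1 - p) * δ * i t) T hT
      ?_ ?_ (by fun_prop) (by fun_prop) (by fun_prop) (by fun_prop) ?_ ?_ ?_ ?_ ha0 (by linarith)
    · intro t ht _
      convert ha t ht using 1
      ring
    · intro t ht _
      refine (((ha t ht).const_sub 1).sub (hi t ht)).congr_deriv ?_
      ring
    · intro t ht _; have := ipos t ht; positivity
    · intro t ht _; positivity
    · intro t ht _; have := ipos t ht; positivity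
    · intro t ht _
      have := ipos t ht
      exact mul_nonneg (mul_nonneg (by linarith) hδ_pos.le) this
  have apos := fun t ht => (aspos t ht).1
  have spos := fun t ht => (aspos t ht).2
  -- the nullcline function
  obtain ⟨G, hGdef⟩ : ∃ G : ℝ → ℝ, ∀ t, G t = β * i t + (β - βa) * a t - (β - δ) := ⟨_, fun _ => rfl⟩
  obtain ⟨F, hFdef⟩ : ∃ F : ℝ → ℝ, ∀ t, F t = αi * (1 - a t - i t) * (i t) + αa * (1 - a t - i t) * (a t) + p * δ * (i t) - βa * (a t) * (i t) - δa * (a t) := ⟨_, fun _ => rfl⟩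
  have ha' : ∀ t, 0 ≤ t → HasDerivAt a (F t) t := by
    intro t ht; rw [hFdef]; exact ha t ht
  have hi' : ∀ t, 0 ≤ t → HasDerivAt i (-(G t * i t)) t := by
    intro t ht; convert hi t ht using 1; rw [hGdef]; ring
  have hG' : ∀ t, 0 ≤ t → HasDerivAt G (β * (-(G t * i t)) + (β - βa) * F t) t := by
    intro t ht
    have : G = fun t => β * i t + (β - βa) * a t - (β - δ) := funext hGdef
    conv => arg 1; rw [this]
    exact (((hi' t ht).const_mul β).add ((ha' t ht).const_mul (β - βa))).sub_const _
  have hbb : 0 < β - βa := by linarith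
  have hbd : 0 < β - δ := by linarith
  obtain ⟨κ, hκ⟩ : ∃ κ, κ = (αa - δa) / (β - δ) := ⟨_, rfl⟩
  have hκpos : 0 < κ := by rw [hκ]; exact div_pos (by linarith) hbd
  have hκe : κ * (β - δ) = αa - δa := by rw [hκ]; field_simp
  obtain ⟨ε, hε⟩ : ∃ ε, ε = κ * (β - βa) - αa := ⟨_, rfl⟩
  obtain ⟨c, hc⟩ : ∃ c, c = κ * β - (αa + βa) := ⟨_, rfl⟩
  have hεpos : 0 < ε := by
    have h1 : αa * (β - δ) < (β - βa) * (αa - δa) := by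
      have : αa * (β - δ - (β - βa) * (1 - δa / αa)) < 0 := mul_neg_of_pos_of_neg hαa_pos hlam2
      have e : αa * (β - δ - (β - βa) * (1 - δa / αa)) = αa * (β - δ) - (β - βa) * (αa - δa) := by
        field_simp
      linarith
    have h2 : 0 < ε * (β - δ) := by
      have : ε * (β - δ) = (κ * (β - δ)) * (β - βa) - αa * (β - δ) := by rw [hε]; ring
      rw [this, hκe]; linarith
    exact pos_of_mul_pos_left h2 hbd.le
  have hcpos : 0 ≤ c := by
    have h1 : (β - δ) * (αa + βa) ≤ (αa - δa) * β := by
      have e : 1 - δ / β = (β - δ) / β := by field_simp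
      rw [ge_iff_le, e, div_le_div_iff₀ hβ (by linarith)] at hb1
      exact hb1
    have h2 : 0 ≤ c * (β - δ) := by
      have : c * (β - δ) = (κ * (β - δ)) * β - (β - δ) * (αa + βa) := by rw [hc]; ring
      rw [this, hκe]; linarith
    exact nonneg_of_mul_nonneg_left h2 hbd
  have hF : ∀ t, F t = i t * (αi * (1 - a t - i t) + p * δ) + a t * (-κ * G t + ε * a t + c * i t) := by
    intro t
    have e : -κ * G t + ε * a t + c * i t = (αa - δa) - αa * a t - (αa + βa) * i t := by
      rw [← hκe, hGdef, hε, hc]; ring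
    rw [e, hFdef]; ring
  have a1 : ∀ t, 0 ≤ t → a t ≤ 1 := fun t ht => by
    have := spos t ht; have := ipos t ht; linarith
  have i1 : ∀ t, 0 ≤ t → i t ≤ 1 := fun t ht => by
    have := spos t ht; have := apos t ht; linarith
  have hFsq : ∀ t, 0 ≤ t → G t ≤ 0 → ε * (a t)^2 ≤ F t := by
    intro t ht hg
    have h1 := apos t ht
    have h2 := ipos t ht
    have h3 := spos t ht
    rw [hF]
    have k1 : 0 ≤ i t * (αi * (1 - a t - i t) + p * δ) := by positivity
    have k2 : 0 ≤ a t * (κ * (-G t)) := mul_nonneg h1 (mul_nonneg hκpos.le (by linarith))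
    have k3 : 0 ≤ a t * (c * i t) := by positivity
    nlinarith
  -- lower bound
  have lower : ∀ m, 0 < m → ∃ η L, 0 < η ∧ 0 ≤ L ∧ ∀ t, 0 ≤ t → m ≤ i t →
      η - L * max (G t) 0 ≤ F t := by
    intro m hm
    obtain ⟨r, hr⟩ : ∃ r, r = αi * δ + β * (p * δ) := ⟨_, rfl⟩
    have hrpos : 0 < r := by
      rw [hr]
      rcases hαi_nonneg.eq_or_lt with h | h
      · have : 0 < p := by linarith
        positivity
      · positivity
    obtain ⟨θ, hθ⟩ : ∃ θ, θ = r / (2 * (αi * βa + 1)) := ⟨_, rfl⟩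
    have hden : 0 < αi * βa + 1 := by positivity
    have hθpos : 0 < θ := by rw [hθ]; positivity
    have hθe : αi * βa * θ ≤ r / 2 := by
      have : (αi * βa + 1) * θ = r / 2 := by rw [hθ]; field_simp
      linarith
    refine ⟨min (m * (r / 2) / β) (ε * θ^2), κ + αi / β, by positivity, by positivity, ?_⟩
    intro t ht hmi
    have h1 := apos t ht
    have h2 := ipos t ht
    have h3 := spos t ht
    have h4 := a1 t ht
    have h5 := i1 t ht
    have g0 : 0 ≤ max (G t) 0 := le_max_right _ _
    have g1 : G t ≤ max (G t) 0 := le_max_left _ _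
    rw [hF]
    have k0 : -κ * max (G t) 0 ≤ a t * (-κ * G t) := by
      have x1 : a t * (κ * G t) ≤ a t * (κ * max (G t) 0) := by gcongr
      have x2 : a t * (κ * max (G t) 0) ≤ 1 * (κ * max (G t) 0) := by gcongr
      linarith
    have k3 : 0 ≤ a t * (c * i t) := by positivity
    have k4 : 0 ≤ αi / β * max (G t) 0 := by positivity
    by_cases hcase : a t ≤ θ
    · have q1 : min (m * (r / 2) / β) (ε * θ^2) ≤ m * (r / 2) / β := min_le_left _ _
      have k5 : 0 ≤ ε * (a t)^2 := by positivity
      have q2 : r / 2 / β - αi / β * max (G t) 0 ≤ αi * (1 - a t - i t) + p * δ := by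
        have e1 : β * (1 - a t - i t) = δ - βa * a t - G t := by rw [hGdef]; ring
        have e2 : αi * βa * a t ≤ r / 2 := le_trans (by gcongr) hθe
        have e3 : αi * (β * (1 - a t - i t)) = αi * δ - αi * βa * a t - αi * G t := by rw [e1]; ring
        have e4 : αi * G t ≤ αi * max (G t) 0 := by gcongr
        have e5 : r / 2 - αi * max (G t) 0 ≤ β * (αi * (1 - a t - i t) + p * δ) := by
          linarith
        have e6 : r / 2 / β - αi / β * max (G t) 0 = (r / 2 - αi * max (G t) 0) / β := by ring
        rw [e6, div_le_iff₀ hβ]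
        linarith
      have q3 := mul_le_mul_of_nonneg_left q2 h2
      have q4 : i t * (αi / β * max (G t) 0) ≤ 1 * (αi / β * max (G t) 0) := by gcongr
      have q5 : m * (r / 2 / β) ≤ i t * (r / 2 / β) := by gcongr
      have q6 : m * (r / 2) / β = m * (r / 2 / β) := by ring
      linarith
    · push Not at hcase
      have q1 : min (m * (r / 2) / β) (ε * θ^2) ≤ ε * θ^2 := min_le_right _ _
      have q2 : ε * θ^2 ≤ ε * (a t)^2 := by gcongr
      have k1 : 0 ≤ i t * (αi * (1 - a t - i t) + p * δ) := by positivity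
      linarith
  -- growth principle
  have grow : ∀ (f f' : ℝ → ℝ) (T η B : ℝ), 0 < η → (∀ t, T ≤ t → HasDerivAt f (f' t) t) →
      (∀ t, T ≤ t → η ≤ f' t) → (∀ t, T ≤ t → f t ≤ B) → False := by
    intro f f' T η B hη hf hf' hB
    have hS : T ≤ T + (|B - f T| + 1) / η := by
      have : 0 ≤ (|B - f T| + 1) / η := by positivity
      linarith
    have := sais_mono (fun t => f t - η * t) (fun t => f' t - η * 1) T (T + (|B - f T| + 1) / η)
      (fun t ht _ => (hf t ht).sub ((hasDerivAt_id t).const_mul η))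
      (fun t ht _ => by have := hf' t ht; linarith) hS
    have hb := hB _ hS
    have e : η * ((|B - f T| + 1) / η) = |B - f T| + 1 := by field_simp
    simp only [mul_add, e] at this
    have := le_abs_self (B - f T)
    linarith
  -- Claim A
  have claimA : ∃ T, 0 ≤ T ∧ 0 ≤ G T := by
    by_contra hcon
    push Not at hcon
    rcases hi0.eq_or_lt with h | h
    · have ha0' : 0 < a 0 := by
        rcases ha0.eq_or_lt with h' | h'
        · exact absurd (by rw [← h, ← h']) hne
        · exact h'
      refine grow a F 0 (ε * (a 0)^2) 1 (by positivity) ha' ?_ a1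
      intro t ht
      have hm : a 0 ≤ a t := sais_mono a F 0 t (fun r hr _ => ha' r hr)
        (fun r hr _ => le_trans (by positivity) (hFsq r hr (hcon r hr).le)) ht
      refine le_trans ?_ (hFsq t ht (hcon t ht).le)
      gcongr
    · obtain ⟨η, L, hη, hL, hlow⟩ := lower (i 0) h
      refine grow a F 0 η 1 hη ha' ?_ a1
      intro t ht
      have hm : i 0 ≤ i t := sais_mono i _ 0 t (fun r hr _ => hi' r hr)
        (fun r hr _ => by
          have := mul_nonneg (neg_nonneg.mpr (hcon r hr).le) (ipos r hr)
          linarith) ht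
      have := hlow t ht hm
      rw [max_eq_right (hcon t ht).le] at this
      linarith
  obtain ⟨T, hT, hGT⟩ := claimA
  have claimB : ∀ t, T ≤ t → 0 ≤ G t := by
    intro t ht
    have := sais_mono (fun t => -(min (G t) 0)^2) _ T t
      (fun r hr _ => ((sais_neg (G r)).comp r (hG' r (hT.trans hr))).neg) ?_ ht
    · simp only [min_eq_right hGT] at this
      have : (min (G t) 0) = 0 := by
        have : (min (G t) 0)^2 = 0 := by nlinarith [sq_nonneg (min (G t) 0)]
        simpa using this
      exact min_eq_right_iff.mp this
    · intro r hr _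
      have hr0 := hT.trans hr
      rcases le_total (G r) 0 with h | h
      · rw [min_eq_left h]
        have k1 : 0 ≤ F r := le_trans (by positivity) (hFsq r hr0 h)
        have k2 := ipos r hr0
        have k3 : 0 ≤ β * i r * (G r)^2 := by positivity
        have k4 : 0 ≤ (-G r) * ((β - βa) * F r) :=
          mul_nonneg (by linarith) (mul_nonneg hbb.le k1)
        nlinarith
      · rw [min_eq_right h]; simp
  have ianti : ∀ r t, T ≤ r → r ≤ t → i t ≤ i r := by
    intro r t hr hrt
    have := sais_mono (fun t => - i t) _ r t
      (fun q hq _ => (hi' q (hT.trans (hr.trans hq))).neg)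
      (fun q hq _ => by
        have := mul_nonneg (claimB q (hr.trans hq)) (ipos q (hT.trans (hr.trans hq)))
        linarith) hrt
    linarith
  have ismall : ∀ m, 0 < m → ∃ t, T ≤ t ∧ i t < m := by
    intro m hm
    by_contra hcon
    push Not at hcon
    obtain ⟨η, L, hη, hL, hlow⟩ := lower m hm
    obtain ⟨L', hL'⟩ : ∃ L', L' = β + (β - βa) * L := ⟨_, rfl⟩
    have hL'0 : 0 ≤ L' := by rw [hL']; positivity
    refine grow (fun t => G t - (L' / m) * i t) _ T ((β - βa) * η) (β + (β - βa)) (by positivity)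
      (fun t ht => (hG' t (hT.trans ht)).sub ((hi' t (hT.trans ht)).const_mul (L' / m))) ?_ ?_
    · intro t ht
      have ht0 := hT.trans ht
      have l := hlow t ht0 (hcon t ht)
      have g := claimB t ht
      rw [max_eq_left g] at l
      have l2 := mul_le_mul_of_nonneg_left l hbb.le
      have x1 : G t * i t ≤ G t * 1 := by gcongr; exact i1 t ht0
      have x2 : L' / m * (G t * m) ≤ L' / m * (G t * i t) := by gcongr; exact hcon t ht
      have x3 : L' / m * (G t * m) = L' * G t := by field_simp
      rw [x3, hL'] at x2
      rw [hL']
      nlinarith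
    · intro t ht
      have ht0 := hT.trans ht
      have y1 := ipos t ht0
      have y2 := mul_le_mul_of_nonneg_left (i1 t ht0) hβ.le
      have y3 := mul_le_mul_of_nonneg_left (a1 t ht0) hbb.le
      have y4 : 0 ≤ L' / m * i t := by positivity
      have := hGdef t
      linarith
  have ilim : Tendsto i atTop (nhds 0) := by
    rw [Metric.tendsto_atTop]
    intro m hm
    obtain ⟨r, hr, hrm⟩ := ismall m hm
    refine ⟨r, fun t ht => ?_⟩
    rw [Real.dist_eq, sub_zero, abs_of_nonneg (ipos t (hT.trans (hr.trans ht)))]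
    exact (ianti r t hr ht).trans_lt hrm
  -- a lower bound
  obtain ⟨ρ, hρ⟩ : ∃ ρ, ρ = (β - δ) / (2 * (β - βa)) := ⟨_, rfl⟩
  have hρpos : 0 < ρ := by rw [hρ]; positivity
  obtain ⟨S, hS, hSm⟩ := ismall ((β - δ) / (2 * β)) (by positivity)
  have alow : ∀ t, S ≤ t → ρ ≤ a t := by
    intro t ht
    have z1 := (ianti S t hS ht).trans hSm.le
    have z2 := claimB t (hS.trans ht)
    rw [hGdef] at z2
    rw [le_div_iff₀ (by positivity)] at z1
    rw [hρ, div_le_iff₀ (by positivity)]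
    nlinarith
  obtain ⟨A, hA⟩ : ∃ A, A = 1 - δa / αa := ⟨_, rfl⟩
  have hAe : αa * A = αa - δa := by rw [hA]; field_simp
  have hA0 : 0 ≤ A := by
    rw [hA]; have : δa / αa < 1 := by rw [div_lt_one hαa_pos]; exact hR0a
    linarith
  have hA1 : A ≤ 1 := by
    rw [hA]; have : 0 ≤ δa / αa := by positivity
    linarith
  have vlim : Tendsto (fun t => (a t - A)^2) atTop (nhds 0) := by
    refine sais_decay _ (fun t => 2 * (a t - A) * F t) (fun t => 2 * (αi + p * δ + βa + αa) * i t)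
      (2 * αa * ρ) S (by positivity) ?_ ?_ ?_ (fun t _ => sq_nonneg _)
    · intro t ht
      have := ((ha' t (hT.trans (hS.trans ht))).sub_const A).pow 2
      refine HasDerivAt.congr_deriv this ?_
      norm_num
    · intro t ht
      have ht0 := hT.trans (hS.trans ht)
      have h1 := apos t ht0
      have h2 := ipos t ht0
      have h3 := spos t ht0
      have h4 := a1 t ht0
      have h5 := i1 t ht0
      have h6 := alow t ht
      have e : F t = i t * (αi * (1 - a t - i t) + p * δ - (βa + αa) * a t) + αa * a t * (A - a t) := by
        have : αa * a t * (A - a t) = a t * (αa * A) - αa * a t * a t := by ring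
        rw [this, hAe, hFdef]; ring
      obtain ⟨Q, hQ⟩ : ∃ Q, Q = αi * (1 - a t - i t) + p * δ - (βa + αa) * a t := ⟨_, rfl⟩
      have hQb : |Q| ≤ αi + p * δ + βa + αa := by
        have u1 : 0 ≤ αi * (1 - a t - i t) := by positivity
        have u2 : αi * (1 - a t - i t) ≤ αi * 1 := by gcongr; linarith
        have u3 : 0 ≤ (βa + αa) * a t := by positivity
        have u4 : (βa + αa) * a t ≤ (βa + αa) * 1 := by gcongr
        have u5 : 0 ≤ p * δ := by positivity
        rw [abs_le, hQ]
        constructor <;> linarith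
      have hAb : |a t - A| ≤ 1 := by rw [abs_le]; constructor <;> linarith
      have hprod : (a t - A) * Q ≤ αi + p * δ + βa + αa := by
        refine (le_abs_self _).trans ?_
        rw [abs_mul]
        calc |a t - A| * |Q| ≤ 1 * |Q| := by gcongr
          _ ≤ _ := by linarith
      rw [e, ← hQ]
      have w1 := mul_le_mul_of_nonneg_right hprod h2
      have w2 : αa * ρ * (a t - A)^2 ≤ αa * a t * (a t - A)^2 := by gcongr
      nlinarith
    · simpa using ilim.const_mul (2 * (αi + p * δ + βa + αa))
  have alim : Tendsto a atTop (nhds A) := by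
    have h1 : Tendsto (fun t => |a t - A|) atTop (nhds 0) := by
      have := vlim.sqrt
      simpa [Real.sqrt_sq_eq_abs] using this
    have h2 := (tendsto_zero_iff_abs_tendsto_zero (fun t => a t - A)).mpr h1
    simpa using h2.add_const A
  rw [← hA]
  exact alim.prodMk_nhds ilim
end

section
/- Consider the SAUIS model with α_a > δ_a, and set a₀* = δ_u·(1 − δ_a/α_a) / (δ_a·(1 + α_u/α_a) + δ_u) and u₀* = (1 − δ_a/α_a) · δ_a·(1 + α_u/α_a) / (δ_a·(1 + α_u/α_a) + δ_u). Then (a₀*, u₀*, 0) is an equilibrium of the SAUIS system satisfying a₀* > 0, u₀* > 0, and a₀* + u₀* < 1, and it is the unique equilibrium of the system with i = 0 and a > 0. Conversely, if α_a ≤ δ_a, then no equilibrium with i = 0 and a > 0 exists in Ω. -/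
open Set Filter

theorem sauis_disease_free_equilibrium_P2
    (αi αa αu δ δa δu β βa βu p q : ℝ)
    (hαi : 0 < αi) (hαa : 0 < αa) (hαu : 0 < αu)
    (hδ : 0 < δ) (hδa : 0 < δa) (hδu : 0 < δu)
    (hβa0 : 0 ≤ βa) (hβaβ : βa < β) (hβu0 : 0 ≤ βu) (hβuβ : βu < β)
    (hp : 0 ≤ p) (hq : 0 ≤ q) (hpq : p + q ≤ 1)
 :
    (δa < αa →
      ((αi * (1 - δu * (1 - δa / αa) / (δa * (1 + αu / αa) + δu) - (1 - δa / αa) * (δa * (1 + αu / αa)) / (δa * (1 + αu / αa) + δu) - (0:ℝ)) * ((0:ℝ)) + αa * (1 - δu * (1 - δa / αa) / (δa * (1 + αu / αa) + δu) - (1 - δa / αa) * (δa * (1 + αu / αa)) / (δa * (1 + αu / αa) + δu) - (0:ℝ)) * (δu * (1 - δa / αa) / (δa * (1 + αu / αa) + δu)) + p * δ * ((0:ℝ)) - βa * (δu * (1 - δa / αa) / (δa * (1 + αu / αa) + δu)) * ((0:ℝ)) - δa * (δu * (1 - δa / αa) / (δa * (1 + αu / αa) + δu))) = 0 ∧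
       (δa * (δu * (1 - δa / αa) / (δa * (1 + αu / αa) + δu)) + αu * (1 - δu * (1 - δa / αa) / (δa * (1 + αu / αa) + δu) - (1 - δa / αa) * (δa * (1 + αu / αa)) / (δa * (1 + αu / αa) + δu) - (0:ℝ)) * (δu * (1 - δa / αa) / (δa * (1 + αu / αa) + δu)) + q * δ * ((0:ℝ)) - βu * ((1 - δa / αa) * (δa * (1 + αu / αa)) / (δa * (1 + αu / αa) + δu)) * ((0:ℝ)) - δu * ((1 - δa / αa) * (δa * (1 + αu / αa)) / (δa * (1 + αu / αa) + δu))) = 0 ∧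
       ((β * (1 - δu * (1 - δa / αa) / (δa * (1 + αu / αa) + δu) - (1 - δa / αa) * (δa * (1 + αu / αa)) / (δa * (1 + αu / αa) + δu) - (0:ℝ)) + βa * (δu * (1 - δa / αa) / (δa * (1 + αu / αa) + δu)) + βu * ((1 - δa / αa) * (δa * (1 + αu / αa)) / (δa * (1 + αu / αa) + δu)) - δ) * ((0:ℝ))) = 0 ∧
       0 < δu * (1 - δa / αa) / (δa * (1 + αu / αa) + δu) ∧ 0 < (1 - δa / αa) * (δa * (1 + αu / αa)) / (δa * (1 + αu / αa) + δu) ∧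
       δu * (1 - δa / αa) / (δa * (1 + αu / αa) + δu) + (1 - δa / αa) * (δa * (1 + αu / αa)) / (δa * (1 + αu / αa) + δu) < 1 ∧
       (∀ a0 u0 : ℝ, 0 < a0 →
         (αi * (1 - a0 - u0 - (0:ℝ)) * ((0:ℝ)) + αa * (1 - a0 - u0 - (0:ℝ)) * (a0) + p * δ * ((0:ℝ)) - βa * (a0) * ((0:ℝ)) - δa * (a0)) = 0 →
         (δa * (a0) + αu * (1 - a0 - u0 - (0:ℝ)) * (a0) + q * δ * ((0:ℝ)) - βu * (u0) * ((0:ℝ)) - δu * (u0)) = 0 →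
         a0 = δu * (1 - δa / αa) / (δa * (1 + αu / αa) + δu) ∧ u0 = (1 - δa / αa) * (δa * (1 + αu / αa)) / (δa * (1 + αu / αa) + δu)))) ∧
    (αa ≤ δa →
      ¬ ∃ a0 u0 : ℝ, 0 < a0 ∧ 0 ≤ u0 ∧ a0 + u0 ≤ 1 ∧
        (αi * (1 - a0 - u0 - (0:ℝ)) * ((0:ℝ)) + αa * (1 - a0 - u0 - (0:ℝ)) * (a0) + p * δ * ((0:ℝ)) - βa * (a0) * ((0:ℝ)) - δa * (a0)) = 0 ∧
        (δa * (a0) + αu * (1 - a0 - u0 - (0:ℝ)) * (a0) + q * δ * ((0:ℝ)) - βu * (u0) * ((0:ℝ)) - δu * (u0)) = 0) := by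
  obtain ⟨r, hr⟩ : ∃ r, r = δa / αa := ⟨_, rfl⟩
  obtain ⟨W, hW⟩ : ∃ W, W = δa * (1 + αu / αa) := ⟨_, rfl⟩
  have hrp : 0 < r := by rw [hr]; positivity
  have hWp : 0 < W := by rw [hW]; positivity
  have hra : αa * r = δa := by rw [hr]; field_simp
  have hWr : δa + αu * r = W := by rw [hr, hW]; field_simp
  have hD : 0 < W + δu := by positivity
  rw [← hr, ← hW]
  constructor
  · intro hlt
    have hr1 : 0 < 1 - r := by
      have : r < 1 := by rw [hr]; exact (div_lt_one hαa).2 hlt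
      linarith
    obtain ⟨A, hA⟩ : ∃ A, A = δu * (1 - r) / (W + δu) := ⟨_, rfl⟩
    obtain ⟨U, hU⟩ : ∃ U, U = (1 - r) * W / (W + δu) := ⟨_, rfl⟩
    have hAp : 0 < A := by rw [hA]; positivity
    have hUp : 0 < U := by rw [hU]; positivity
    have hs : A + U = 1 - r := by rw [hA, hU]; field_simp; ring
    have hAU : W * A = δu * U := by rw [hA, hU]; field_simp
    rw [← hA, ← hU]
    have hs' : 1 - A - U = r := by linarith
    refine ⟨?_, ?_, by ring, hAp, hUp, by linarith, ?_⟩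
    · rw [hs']; linear_combination A * hra
    · rw [hs']; linear_combination A * hWr + hAU
    · intro a u ha h1 h2
      have h3 : 1 - a - u = r := by
        have h4 : αa * a * ((1 - a - u) - r) = 0 := by
          linear_combination h1 - a * hra
        have h5 : αa * a ≠ 0 := by positivity
        have := (mul_eq_zero.1 h4).resolve_left h5
        linarith
      rw [h3] at h2
      have h6 : W * a = δu * u := by linear_combination h2 - a * hWr
      constructor
      · rw [hA, eq_div_iff hD.ne']
        linear_combination h6 - δu * h3
      · rw [hU, eq_div_iff hD.ne']
        linear_combination -h6 - W * h3
  · rintro hle ⟨a, u, ha, hu, hau, h1, h2⟩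
    have h4 : a * (αa * (1 - a - u) - δa) = 0 := by linear_combination h1
    have h5 := (mul_eq_zero.1 h4).resolve_left ha.ne'
    have : 0 < αa * a := by positivity
    have : 0 ≤ αa * u := by positivity
    nlinarith
end
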